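/- arXiv:1905.04360 — 4 statements merged into one kernel-verified Lean document; each statement's English description precedes it below -/
import Mathlib

section
/- Let {ζ_i}_{i=1}^∞ be a sequence of random probability measures on ℝ that is uniformly subgaussian (i.e., there exist C, c > 0 such that almost surely, for every i and every t > 0, ζ_i({x : |x| ≥ t}) ≤ C e^{−c t²}), and let μ be a non-random, absolutely continuous, subgaussian probability measure on ℝ. Suppose that for every k ∈ ℕ: (i) E ∫_ℝ x^k dζ_i(x) → ∫_ℝ x^k dμ(x) as i → ∞, and (ii) Σ_{i=1}^∞ Var(∫_ℝ x^k dζ_i(x)) < ∞. Then ζ_i converges almost surely to μ; that is, for every a, b ∈ ℝ with a < b, the random variable ζ_i(a,b) converges to μ(a,b) almost surely. -/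
open MeasureTheory ProbabilityTheory Filter
open scoped ENNReal

/-- A subgaussian tail bound controls all exponential moments, by a constant depending only on
the parameters of the bound. -/
lemma exists_integral_exp_abs_le_of_subgaussian {C c : ℝ} (hC : 0 < C) (hc : 0 < c) (s : ℝ) :
    ∃ M : ℝ, 0 ≤ M ∧ ∀ ν : Measure ℝ, IsProbabilityMeasure ν →
      (∀ t : ℝ, 0 < t → ν {x | t ≤ |x|} ≤ ENNReal.ofReal (C * Real.exp (-c * t ^ 2))) →
      Integrable (fun x => Real.exp (s * |x|)) ν ∧ ∫ x, Real.exp (s * |x|) ∂ν ≤ M := by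
  wlog hs : 0 ≤ s generalizing s
  · obtain ⟨M, hM, h⟩ := this 0 le_rfl
    refine ⟨M, hM, fun ν hν ht => ?_⟩
    obtain ⟨hi, hle⟩ := h ν hν ht
    have hmono : ∀ x : ℝ, Real.exp (s * |x|) ≤ Real.exp (0 * |x|) := fun x => by
      have := abs_nonneg x
      gcongr
      linarith
    have hint : Integrable (fun x => Real.exp (s * |x|)) ν :=
      hi.mono' (by fun_prop) (ae_of_all _ fun x => by simpa using hmono x)
    exact ⟨hint, (integral_mono hint hi hmono).trans hle⟩
  let f : ℕ → ℝ := fun n => Real.exp (s * (n + 1)) * ((C + 1) * Real.exp (-c * n ^ 2))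
  have hf0 : ∀ n, 0 ≤ f n := fun n => by positivity
  have hf : Summable f := by
    refine Summable.of_nonneg_of_le hf0 (fun n => ?_)
      (Real.summable_exp_neg_nat.mul_left ((C + 1) * Real.exp (s + (s + 1) ^ 2 / (4 * c))))
    have h : s * (n + 1) + -c * n ^ 2 ≤ s + (s + 1) ^ 2 / (4 * c) + -n := by
      have : (s + 1) * n - c * n ^ 2 ≤ (s + 1) ^ 2 / (4 * c) := by
        rw [le_div_iff₀ (by positivity)]
        nlinarith [sq_nonneg ((s + 1) - 2 * c * n)]
      linarith
    calc f n = (C + 1) * Real.exp (s * (n + 1) + -c * n ^ 2) := by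
          simp only [f, Real.exp_add]; ring
      _ ≤ (C + 1) * Real.exp (s + (s + 1) ^ 2 / (4 * c) + -n) := by gcongr
      _ = _ := by rw [Real.exp_add _ (-(n : ℝ))]; ring
  refine ⟨∑' n, f n, tsum_nonneg hf0, fun ν hν ht => ?_⟩
  have hle : ∫⁻ x, ENNReal.ofReal (Real.exp (s * |x|)) ∂ν ≤ ENNReal.ofReal (∑' n, f n) := by
    have hmeas : ∀ n : ℕ, MeasurableSet {x : ℝ | (n : ℝ) ≤ |x|} := fun n =>
      measurableSet_le measurable_const measurable_norm
    calc ∫⁻ x, ENNReal.ofReal (Real.exp (s * |x|)) ∂ν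
        ≤ ∫⁻ x, ∑' n : ℕ, {x : ℝ | (n : ℝ) ≤ |x|}.indicator
            (fun _ => ENNReal.ofReal (Real.exp (s * (n + 1)))) x ∂ν := by
          refine lintegral_mono fun x => ?_
          refine le_trans ?_ (ENNReal.le_tsum ⌊|x|⌋₊)
          have h1 : (⌊|x|⌋₊ : ℝ) ≤ |x| := Nat.floor_le (abs_nonneg x)
          rw [Set.indicator_of_mem (by exact h1)]
          have := (Nat.lt_floor_add_one |x|).le
          gcongr
      _ = ∑' n : ℕ, ENNReal.ofReal (Real.exp (s * (n + 1))) * ν {x : ℝ | (n : ℝ) ≤ |x|} := by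
          rw [lintegral_tsum fun n => (measurable_const.indicator (hmeas n)).aemeasurable]
          simp_rw [lintegral_indicator_const (hmeas _)]
      _ ≤ ∑' n, ENNReal.ofReal (f n) := by
          refine ENNReal.tsum_le_tsum fun n => ?_
          rw [ENNReal.ofReal_mul (Real.exp_nonneg _)]
          gcongr
          rcases n.eq_zero_or_pos with rfl | hn
          · refine prob_le_one.trans ?_
            simp [hC.le]
          · refine (ht n (by exact_mod_cast hn)).trans ?_
            gcongr
            linarith
      _ = ENNReal.ofReal (∑' n, f n) := (ENNReal.ofReal_tsum_of_nonneg hf0 hf).symm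
  have hint : Integrable (fun x => Real.exp (s * |x|)) ν := by
    refine ⟨by fun_prop, ?_⟩
    rw [hasFiniteIntegral_iff_ofReal (ae_of_all _ fun x => Real.exp_nonneg _)]
    exact hle.trans_lt ENNReal.ofReal_lt_top
  refine ⟨hint, ?_⟩
  rw [← ofReal_integral_eq_lintegral_ofReal hint (ae_of_all _ fun x => Real.exp_nonneg _)] at hle
  exact (ENNReal.ofReal_le_ofReal_iff (tsum_nonneg hf0)).1 hle

/-- The power series of `exp (t * x * I)` is dominated by a geometric series with the weight
`exp (2 * |t| * |x|)`. -/
lemma norm_pow_div_factorial_le (t x : ℝ) (k : ℕ) :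
    ‖(t * x * Complex.I : ℂ) ^ k / (k.factorial : ℂ)‖ ≤
      (1 / 2) ^ k * Real.exp (2 * |t| * |x|) := by
  have h := Real.pow_div_factorial_le_exp (x := 2 * |t| * |x|) (by positivity) k
  calc ‖(t * x * Complex.I : ℂ) ^ k / (k.factorial : ℂ)‖
      = (1 / 2) ^ k * ((2 * |t| * |x|) ^ k / k.factorial) := by
        simp only [norm_div, norm_pow, norm_mul, Complex.norm_real, Complex.norm_I,
          Complex.norm_natCast, Real.norm_eq_abs]
        rw [← mul_div_assoc, ← mul_pow]
        ring_nf
    _ ≤ _ := by gcongr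

/-- If all exponential moments are finite, the characteristic function is the sum of its moment
series. -/
lemma hasSum_charFun_of_integrable_exp {ν : Measure ℝ} {t : ℝ}
    (h : Integrable (fun x => Real.exp (2 * |t| * |x|)) ν) :
    HasSum (fun k : ℕ => (t * Complex.I) ^ k / (k.factorial : ℂ) * ((∫ x, x ^ k ∂ν : ℝ) : ℂ))
        (charFun ν t) ∧
      ∀ k : ℕ, ‖(t * Complex.I) ^ k / (k.factorial : ℂ) * ((∫ x, x ^ k ∂ν : ℝ) : ℂ)‖ ≤
        (1 / 2) ^ k * ∫ x, Real.exp (2 * |t| * |x|) ∂ν := by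
  let F : ℕ → ℝ → ℂ := fun k x => (t * x * Complex.I : ℂ) ^ k / (k.factorial : ℂ)
  have hFint : ∀ k, Integrable (F k) ν := fun k =>
    (h.const_mul ((1 / 2) ^ k)).mono' (by fun_prop)
      (ae_of_all _ fun x => norm_pow_div_factorial_le t x k)
  have hFle : ∀ k, ∫ x, ‖F k x‖ ∂ν ≤ (1 / 2) ^ k * ∫ x, Real.exp (2 * |t| * |x|) ∂ν := fun k => by
    rw [← integral_const_mul]
    exact integral_mono (hFint k).norm (h.const_mul _) fun x => norm_pow_div_factorial_le t x k
  have hterm : ∀ k, ∫ x, F k x ∂ν =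
      (t * Complex.I) ^ k / (k.factorial : ℂ) * ((∫ x, x ^ k ∂ν : ℝ) : ℂ) := fun k => by
    rw [← integral_complex_ofReal, ← integral_const_mul]
    refine integral_congr_ae (ae_of_all _ fun x => ?_)
    simp only [F]
    push_cast
    ring
  simp_rw [← hterm]
  refine ⟨?_, fun k => (norm_integral_le_integral_norm _).trans (hFle k)⟩
  have hsum := hasSum_integral_of_summable_integral_norm hFint
    (Summable.of_nonneg_of_le (fun k => integral_nonneg fun x => norm_nonneg _) hFle
      ((summable_geometric_of_lt_one (by norm_num) (by norm_num)).mul_right _))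
  suffices heq : charFun ν t = ∫ x, ∑' k, F k x ∂ν from heq ▸ hsum
  rw [charFun_apply_real]
  refine integral_congr_ae (ae_of_all _ fun x => ?_)
  simp only [F]
  rw [Complex.exp_eq_exp_ℂ]
  exact (NormedSpace.expSeries_div_hasSum_exp _).tsum_eq.symm

/-- Moment method: a uniformly subgaussian sequence whose moments converge to those of a
subgaussian probability measure has convergent characteristic functions. -/
lemma tendsto_charFun_of_tendsto_moments {C c C' c' : ℝ} (hC : 0 < C) (hc : 0 < c)
    (hC' : 0 < C') (hc' : 0 < c') {ν : ℕ → Measure ℝ} (hν : ∀ i, IsProbabilityMeasure (ν i))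
    (hνsub : ∀ i, ∀ t : ℝ, 0 < t →
      ν i {x | t ≤ |x|} ≤ ENNReal.ofReal (C * Real.exp (-c * t ^ 2)))
    {μ : Measure ℝ} [hμ : IsProbabilityMeasure μ]
    (hμsub : ∀ t : ℝ, 0 < t → μ {x | t ≤ |x|} ≤ ENNReal.ofReal (C' * Real.exp (-c' * t ^ 2)))
    (hmom : ∀ k : ℕ, 0 < k → Tendsto (fun i => ∫ x, x ^ k ∂(ν i)) atTop (nhds (∫ x, x ^ k ∂μ)))
    (t : ℝ) : Tendsto (fun i => charFun (ν i) t) atTop (nhds (charFun μ t)) := by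
  obtain ⟨M, hM0, hM⟩ := exists_integral_exp_abs_le_of_subgaussian hC hc (2 * |t|)
  obtain ⟨M', -, hM'⟩ := exists_integral_exp_abs_le_of_subgaussian hC' hc' (2 * |t|)
  have hi := fun i => hasSum_charFun_of_integrable_exp (hM (ν i) (hν i) (hνsub i)).1
  have hl := hasSum_charFun_of_integrable_exp (hM' μ hμ hμsub).1
  rw [← hl.1.tsum_eq]
  simp_rw [← fun i => (hi i).1.tsum_eq]
  refine tendsto_tsum_of_dominated_convergence (bound := fun k => (1 / 2) ^ k * M)
    ((summable_geometric_of_lt_one (by norm_num) (by norm_num)).mul_right _)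
    (fun k => ?_) (.of_forall fun i k => ?_)
  · refine Tendsto.const_mul _ (Complex.continuous_ofReal.tendsto _ |>.comp ?_)
    rcases k.eq_zero_or_pos with rfl | hk
    · simp
    · exact hmom k hk
  · refine ((hi i).2 k).trans ?_
    have := (hM (ν i) (hν i) (hνsub i)).2
    gcongr

/-- Random variables with summable variances are asymptotically almost surely equal to their
expectations. -/
lemma ae_tendsto_of_tsum_evariance_lt_top {Ω : Type*} [MeasurableSpace Ω] {P : Measure Ω}
    {X : ℕ → Ω → ℝ} (hX : ∀ i, Measurable (X i)) {m : ℝ}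
    (hmean : Tendsto (fun i => ∫ ω, X i ω ∂P) atTop (nhds m))
    (hvar : ∑' i, evariance (X i) P < ⊤) :
    ∀ᵐ ω ∂P, Tendsto (fun i => X i ω) atTop (nhds m) := by
  simp only [evariance] at hvar
  have hmeas : ∀ i, Measurable fun ω => ‖X i ω - ∫ ω, X i ω ∂P‖ₑ ^ 2 := fun i =>
    ((hX i).sub_const _).enorm.pow_const 2
  rw [← lintegral_tsum fun i => (hmeas i).aemeasurable] at hvar
  filter_upwards [ae_lt_top (Measurable.tsum hmeas) hvar.ne] with ω hω
  have h0 := ENNReal.tendsto_atTop_zero_of_tsum_ne_top hω.ne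
  have h1 : Tendsto (fun i => (X i ω - ∫ ω, X i ω ∂P) ^ 2) atTop (nhds 0) := by
    have := (ENNReal.tendsto_toReal ENNReal.zero_ne_top).comp h0
    simpa [Function.comp_def] using this
  have h2 : Tendsto (fun i => X i ω - ∫ ω, X i ω ∂P) atTop (nhds 0) := by
    have := h1.sqrt
    simp only [Real.sqrt_sq_eq_abs, Real.sqrt_zero] at this
    exact (tendsto_zero_iff_abs_tendsto_zero _).2 this
  simpa using h2.add hmean

/-- **Moment method criterion.** If `{ζ i}` is a uniformly subgaussian
sequence of random probability measures on `ℝ`, `μ` is a non-random absolutely continuous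
subgaussian probability measure, the expected `k`-th moments of `ζ i` converge to those of
`μ`, and the variances of the `k`-th moments are summable, then `ζ i → μ` almost surely. -/
theorem stmt1 (Ω : Type) [MeasurableSpace Ω] (P : Measure Ω) [IsProbabilityMeasure P]
    (ζ : ℕ → Ω → Measure ℝ)
    (hζmeas : ∀ i, Measurable (ζ i))
    (hζprob : ∀ i ω, IsProbabilityMeasure (ζ i ω))
    (hunif : ∃ C > (0 : ℝ), ∃ c > (0 : ℝ), ∀ᵐ ω ∂P, ∀ i, ∀ t : ℝ, 0 < t →
      ζ i ω {x | t ≤ |x|} ≤ ENNReal.ofReal (C * Real.exp (-c * t ^ 2)))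
    (μ : Measure ℝ) [IsProbabilityMeasure μ] (hac : μ ≪ volume)
    (hμsub : ∃ C > (0 : ℝ), ∃ c > (0 : ℝ), ∀ t : ℝ, 0 < t →
      μ {x | t ≤ |x|} ≤ ENNReal.ofReal (C * Real.exp (-c * t ^ 2)))
    (hmom : ∀ k : ℕ, 0 < k →
      Tendsto (fun i => ∫ ω, (∫ x, x ^ k ∂(ζ i ω)) ∂P) atTop (nhds (∫ x, x ^ k ∂μ)))
    (hvar : ∀ k : ℕ, 0 < k →
      ∑' i, evariance (fun ω => ∫ x, x ^ k ∂(ζ i ω)) P < ⊤)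
    (a b : ℝ) (hab : a < b) :
    ∀ᵐ ω ∂P, Tendsto (fun i => ζ i ω (Set.Ioo a b)) atTop (nhds (μ (Set.Ioo a b))) := by
  obtain ⟨C, hC, c, hc, hsub⟩ := hunif
  obtain ⟨C', hC', c', hc', hμsub⟩ := hμsub
  have hmeas : ∀ k i, Measurable fun ω => ∫ x, x ^ k ∂(ζ i ω) := fun k i => by
    let κ : Kernel Ω ℝ := ⟨ζ i, hζmeas i⟩
    have : IsMarkovKernel κ := ⟨hζprob i⟩
    exact (StronglyMeasurable.integral_kernel (κ := κ)
      (continuous_pow k).stronglyMeasurable).measurable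
  have hconv : ∀ᵐ ω ∂P, ∀ k : ℕ, 0 < k →
      Tendsto (fun i => ∫ x, x ^ k ∂(ζ i ω)) atTop (nhds (∫ x, x ^ k ∂μ)) := by
    rw [ae_all_iff]
    intro k
    by_cases hk : 0 < k
    · filter_upwards [ae_tendsto_of_tsum_evariance_lt_top (hmeas k) (hmom k hk) (hvar k hk)]
        with ω hω _ using hω
    · exact ae_of_all _ fun _ h => absurd h hk
  filter_upwards [hsub, hconv] with ω hω hωconv
  let ν : ℕ → ProbabilityMeasure ℝ := fun i => ⟨ζ i ω, hζprob i ω⟩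
  let μ₀ : ProbabilityMeasure ℝ := ⟨μ, inferInstance⟩
  have hweak : Tendsto ν atTop (nhds μ₀) :=
    ProbabilityMeasure.tendsto_of_tendsto_charFun fun t =>
      tendsto_charFun_of_tendsto_moments hC hc hC' hc' (fun i => hζprob i ω) hω hμsub hωconv t
  refine ProbabilityMeasure.tendsto_measure_of_null_frontier_of_tendsto' hweak ?_
  rw [frontier_Ioo hab]
  exact hac ((Set.toFinite {a, b}).measure_zero _)
end

section
/- Fix k, t ∈ ℕ and let π ∈ Π(k,t) with π ∉ EC(k,t). Then for any sequence of symmetric conference matrices S_n of increasing sizes n, the quantity V_n(π) := (1/n^{k/2+1}) Σ_{a ∈ L_n(π)} Δ(a(1),...,a(k)) satisfies V_n(π) → 0 as n → ∞. -/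
open MeasureTheory ProbabilityTheory Filter Finset
open scoped ENNReal

/-- An `n × n` symmetric conference matrix: symmetric, zero diagonal,
`±1` off the diagonal, and `Sᵀ S = (n-1) I`. -/
def IsConferenceMatrix {n : ℕ} (S : Matrix (Fin n) (Fin n) ℝ) : Prop :=
  S.IsSymm ∧ (∀ i, S i i = 0) ∧ (∀ i j, i ≠ j → S i j = 1 ∨ S i j = -1) ∧
    S.transpose * S = ((n : ℝ) - 1) • 1

/-- The cyclic successor on `Fin k` (so `k + 1` is identified with `1`). -/
def cyc {k : ℕ} (i : Fin k) : Fin k := ⟨(i.val + 1) % k, Nat.mod_lt _ i.pos⟩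

/-- `Δ(a₁, …, a_k) = S_{a₁a₂} S_{a₂a₃} ⋯ S_{a_k a₁}`. -/
def Delta {k n : ℕ} (S : Matrix (Fin n) (Fin n) ℝ) (a : Fin k → Fin n) : ℝ :=
  ∏ i : Fin k, S (a i) (a (cyc i))

/-- The set of level sets of `a : [k] → [n]`, i.e. `{a⁻¹(a(i)) : i ∈ [k]}`. -/
def levelSets {k n : ℕ} (a : Fin k → Fin n) : Finset (Finset (Fin k)) :=
  Finset.image (fun i => Finset.univ.filter fun j => a j = a i) Finset.univ

/-- `L_n(π)`: the functions `a : [k] → [n]` whose level sets are exactly the blocks of `π`. -/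
def Ln {k : ℕ} (n : ℕ) (π : Finset (Finset (Fin k))) : Finset (Fin k → Fin n) :=
  Finset.univ.filter fun a => levelSets a = π

/-- `V_n(π) = n^{-(k/2+1)} Σ_{a ∈ L_n(π)} Δ(a(1), …, a(k))`. -/
noncomputable def Vn {k : ℕ} (n : ℕ) (S : Matrix (Fin n) (Fin n) ℝ)
    (π : Finset (Finset (Fin k))) : ℝ :=
  (∑ a ∈ Ln n π, Delta S a) / (n : ℝ) ^ ((k : ℝ) / 2 + 1)

/-- `π` is a partition of `[k]` into nonempty blocks. -/
def IsPartitionOf (k : ℕ) (π : Finset (Finset (Fin k))) : Prop :=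
  ∅ ∉ π ∧ ∀ i : Fin k, ∃! B, B ∈ π ∧ i ∈ B

/-- The block `π(i)` of `π` containing `i` (a junk value if `π` is not a partition). -/
def part {k : ℕ} (π : Finset (Finset (Fin k))) (i : Fin k) : Finset (Fin k) :=
  Finset.univ.filter fun j => ∀ B ∈ π, (i ∈ B ↔ j ∈ B)

/-- `π` is a crossing partition. -/
def IsCrossing {k : ℕ} (π : Finset (Finset (Fin k))) : Prop :=
  ∃ A ∈ π, ∃ B ∈ π, A ≠ B ∧
    ∃ a₁ ∈ A, ∃ a₂ ∈ A, ∃ b₁ ∈ B, ∃ b₂ ∈ B, a₁ < b₁ ∧ b₁ < a₂ ∧ a₂ < b₂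

/-- `π` is loop-free: `π(x) ≠ π(x+1)` for all `x ∈ [k]` (mod `k`). -/
def LoopFree {k : ℕ} (π : Finset (Finset (Fin k))) : Prop :=
  ∀ x : Fin k, part π x ≠ part π (cyc x)

/-- The edge of the multigraph `G_π` indexed by `x ∈ [k]` (joining `π(x)` and `π(x+1)`)
has endpoints `A` and `B`. -/
def EdgeConnects {k : ℕ} (π : Finset (Finset (Fin k))) (x : Fin k)
    (A B : Finset (Fin k)) : Prop :=
  (part π x = A ∧ part π (cyc x) = B) ∨ (part π x = B ∧ part π (cyc x) = A)

/-- The edges of `G_π` indexed by `T ⊆ [k]` form a simple cycle of length `ℓ`: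
there are `ℓ` distinct vertices `v 0, …, v (ℓ-1)` and a bijection between `T` and the
cyclically consecutive pairs of vertices. -/
def IsSimpleCycleOn {k : ℕ} (π : Finset (Finset (Fin k))) (T : Finset (Fin k))
    (ℓ : ℕ) : Prop :=
  2 ≤ ℓ ∧ ∃ (e : ZMod ℓ ≃ {x // x ∈ T}) (v : ZMod ℓ → Finset (Fin k)),
    Function.Injective v ∧
      ∀ i : ZMod ℓ, EdgeConnects π ((e i : {x // x ∈ T}) : Fin k) (v i) (v (i + 1))

/-- The `k` edges of `G_π` partition into `m` simple cycles of lengths `ℓ 1, …, ℓ m`. -/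
def EdgesPartitionIntoCycles {k : ℕ} (π : Finset (Finset (Fin k))) (m : ℕ)
    (ℓ : Fin m → ℕ) : Prop :=
  ∃ T : Fin m → Finset (Fin k),
    (∀ i j, i ≠ j → Disjoint (T i) (T j)) ∧
    Finset.univ.biUnion T = Finset.univ ∧
    ∀ i, IsSimpleCycleOn π (T i) (ℓ i)

/-- Membership in `EC(k,t)`: a non-crossing partition of `[k]` into `t` blocks whose
multigraph `G_π` has its edges partitioned into simple even cycles. -/
def InEC (k t : ℕ) (π : Finset (Finset (Fin k))) : Prop :=
  IsPartitionOf k π ∧ π.card = t ∧ ¬ IsCrossing π ∧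
    ∃ (m : ℕ) (s : Fin m → ℕ), EdgesPartitionIntoCycles π m fun i => 2 * s i


theorem exists_blockPred {k : ℕ} {ι : Type*} (f : Fin k → ι) :
    ∃ σ : Equiv.Perm (Fin k), (∀ x, f (σ x) = f x) ∧
      ∀ x y, y < x → f y = f x → σ x < x ∧ y ≤ σ x := by
  classical
  have h : ∀ x, ∃ z, f z = f x ∧ (∀ y, y < x → f y = f x → z < x ∧ y ≤ z) ∧
      ((∀ y, f y = f x → x ≤ y) → ∀ y, f y = f x → y ≤ z) := by
    intro x
    by_cases hx : ∃ y, y < x ∧ f y = f x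
    · obtain ⟨z, hz, hmax⟩ := (univ.filter fun y => y < x ∧ f y = f x).exists_max_image id
        (by obtain ⟨y, hy⟩ := hx; exact ⟨y, by simpa using hy⟩)
      simp only [mem_filter, mem_univ, true_and, id] at hz hmax
      refine ⟨z, hz.2, fun y hy hf => ⟨hz.1, hmax y ⟨hy, hf⟩⟩, fun hmin => ?_⟩
      exact absurd (hmin z hz.2) (not_le.mpr hz.1)
    · push Not at hx
      obtain ⟨z, hz, hmax⟩ := (univ.filter fun y => f y = f x).exists_max_image id
        ⟨x, by simp⟩
      simp only [mem_filter, mem_univ, true_and, id] at hz hmax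
      exact ⟨z, hz, fun y hy hf => absurd hf (hx y hy), fun _ y hy => hmax y hy⟩
  choose σ hσ hlt hwrap using h
  have hinj : Function.Injective σ := by
    intro x x' hxx
    have hf : f x = f x' := by rw [← hσ x, ← hσ x', hxx]
    by_contra hne
    wlog hlt' : x < x' generalizing x x'
    · exact this hxx.symm hf.symm (Ne.symm hne) (lt_of_le_of_ne (not_lt.mp hlt') (Ne.symm hne))
    have h1 := hlt x' x hlt' hf
    rw [← hxx] at h1
    by_cases hx : ∀ y, f y = f x → x ≤ y
    · have := hwrap x hx x' hf.symm
      exact absurd h1.1 (not_lt.mpr this)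
    · push Not at hx
      obtain ⟨y, hy, hyx⟩ := hx
      exact absurd (hlt x y hyx hy).1 (not_lt.mpr h1.2)
  exact ⟨Equiv.ofBijective σ (Finite.injective_iff_bijective.mp hinj), hσ, hlt⟩

theorem cyc_injective {k : ℕ} : Function.Injective (cyc (k := k)) := by
  intro x y h
  have h' : (x.val + 1) % k = (y.val + 1) % k := congrArg Fin.val h
  have : x.val % k = y.val % k := Nat.ModEq.add_right_cancel' 1 h'
  rw [Nat.mod_eq_of_lt x.2, Nat.mod_eq_of_lt y.2] at this
  exact Fin.ext this

theorem cyc_val_of_lt {k : ℕ} {x q : Fin k} (h : x < q) : (cyc x).val = x.val + 1 :=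
  Nat.mod_eq_of_lt (by have := q.2; have : x.val < q.val := h; omega)

/-- In a non-crossing labelling, the permutation `x ↦ (block predecessor of x + 1)` visits each
block at most once per orbit. -/
theorem eq_of_sameCycle_of_nonCrossing {k : ℕ} {ι : Type*} {f : Fin k → ι}
    (hf : ∀ a₁ b₁ a₂ b₂ : Fin k, a₁ < b₁ → b₁ < a₂ → a₂ < b₂ → f a₁ = f a₂ → f b₁ = f b₂ →
      f a₁ = f b₁)
    {σ φ : Equiv.Perm (Fin k)} (hσ : ∀ x, f (σ x) = f x)
    (hlt : ∀ x y, y < x → f y = f x → σ x < x ∧ y ≤ σ x) (hφ : ∀ x, φ x = σ (cyc x))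
    {p p' : Fin k} (hp : f p = f p') (hs : φ.SameCycle p p') : p = p' := by
  classical
  by_contra hne
  wlog hpp : p < p' generalizing p p'
  · exact this hp.symm hs.symm (Ne.symm hne) (lt_of_le_of_ne (not_lt.mp hpp) (Ne.symm hne))
  obtain ⟨q, hq, hmin⟩ := (univ.filter fun y => p < y ∧ f y = f p).exists_min_image id
    ⟨p', by simpa using ⟨hpp, hp.symm⟩⟩
  simp only [mem_filter, mem_univ, true_and, id] at hq hmin
  have hinv : ∀ x, p ≤ x ∧ x < q → p ≤ φ x ∧ φ x < q := by
    rintro x ⟨hpx, hxq⟩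
    have hv := cyc_val_of_lt hxq
    have hle : cyc x ≤ q := by
      rw [Fin.le_def, hv]; exact hxq
    have hpc : p < cyc x := by
      rw [Fin.lt_def, hv]; exact Nat.lt_succ_of_le hpx
    rw [hφ]
    rcases hle.eq_or_lt with h | h
    · rw [h]
      exact (hlt q p hq.1 hq.2.symm).symm
    · have hfc : f (cyc x) ≠ f p := fun h' => absurd (hmin _ ⟨hpc, h'⟩) (not_le.mpr h)
      have h1 := hσ (cyc x)
      set y := σ (cyc x)
      constructor
      · by_contra hy
        exact hfc (h1.symm.trans (hf y p (cyc x) q (not_le.mp hy) hpc h h1 hq.2.symm))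
      · by_contra hy
        have hyq : y ≠ q := fun h' => hfc (by rw [← h1, h', hq.2])
        have := hf p (cyc x) q y hpc h (lt_of_le_of_ne (not_lt.mp hy) hyq.symm) hq.2.symm h1.symm
        exact hfc this.symm
  obtain ⟨j, hj⟩ := hs.exists_nat_pow_eq
  have horb : ∀ j : ℕ, p ≤ (φ ^ j) p ∧ (φ ^ j) p < q := by
    intro j
    induction j with
    | zero => exact ⟨le_rfl, hq.1⟩
    | succ j ih => rw [pow_succ', Equiv.Perm.mul_apply]; exact hinv _ ih
  have := (horb j).2
  rw [hj] at this
  exact absurd (hmin p' ⟨hpp, hp.symm⟩) (not_le.mpr this)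

theorem exists_evenCycles {k : ℕ} {π : Finset (Finset (Fin k))}
    (hf : ∀ a₁ b₁ a₂ b₂ : Fin k, a₁ < b₁ → b₁ < a₂ → a₂ < b₂ → part π a₁ = part π a₂ →
      part π b₁ = part π b₂ → part π a₁ = part π b₁)
    {c : Fin k → Bool} (hc : ∀ x y, part π x = part π y → c x = c y)
    (hcyc : ∀ x, c x ≠ c (cyc x)) :
    ∃ (m : ℕ) (s : Fin m → ℕ), EdgesPartitionIntoCycles π m fun i => 2 * s i := by
  classical
  obtain ⟨σ, hσ, hlt⟩ := exists_blockPred (part π)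
  let ρ : Equiv.Perm (Fin k) :=
    Equiv.ofBijective cyc (Finite.injective_iff_bijective.mp cyc_injective)
  let φ : Equiv.Perm (Fin k) := σ * ρ
  have hφ : ∀ x, φ x = σ (cyc x) := fun x => rfl
  have hcφ : ∀ x, c (φ x) = !c x := by
    intro x
    rw [hφ, hc _ _ (hσ (cyc x))]
    have := hcyc x
    revert this
    cases c x <;> cases c (cyc x) <;> simp
  have key : ∀ x₀ : Fin k, ∃ s : ℕ,
      IsSimpleCycleOn π (univ.filter fun y => φ.SameCycle x₀ y) (2 * s) := by
    intro x₀
    have hpos : 0 < Function.minimalPeriod φ x₀ :=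
      Function.minimalPeriod_pos_of_mem_periodicPts
        (Function.Injective.mem_periodicPts φ.injective x₀)
    have hcit : ∀ j, c (φ^[2 * j] x₀) = c x₀ ∧ c (φ^[2 * j + 1] x₀) = !c x₀ := by
      intro j
      induction j with
      | zero => simp [hcφ]
      | succ j ih =>
        have h1 : c (φ^[2 * (j + 1)] x₀) = c x₀ := by
          rw [show 2 * (j + 1) = (2 * j + 1) + 1 by ring, Function.iterate_succ_apply', hcφ, ih.2,
            Bool.not_not]
        exact ⟨h1, by rw [Function.iterate_succ_apply', hcφ, h1]⟩
    obtain ⟨s, hs⟩ : ∃ s, Function.minimalPeriod φ x₀ = 2 * s := by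
      rcases Nat.even_or_odd' (Function.minimalPeriod φ x₀) with ⟨s, h | h⟩
      · exact ⟨s, h⟩
      · have h1 := (hcit s).2
        rw [← h, Function.iterate_minimalPeriod] at h1
        cases hb : c x₀ <;> simp [hb] at h1
    have hne : NeZero (2 * s) := ⟨by omega⟩
    have hmod : ∀ j, φ^[j % (2 * s)] x₀ = φ^[j] x₀ := fun j => by
      rw [← hs, Function.iterate_mod_minimalPeriod_eq]
    have hmem : ∀ j, φ.SameCycle x₀ (φ^[j] x₀) := fun j =>
      ⟨j, by rw [zpow_natCast, Equiv.Perm.coe_pow]⟩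
    refine ⟨s, by omega, Equiv.ofBijective
      (fun j => ⟨φ^[j.val] x₀, by simpa using hmem j.val⟩) ⟨?_, ?_⟩,
      fun j => part π (φ^[j.val] x₀), ?_, ?_⟩
    · intro i j hij
      have : φ^[i.val] x₀ = φ^[j.val] x₀ := congrArg Subtype.val hij
      rw [Function.iterate_eq_iterate_iff_of_lt_minimalPeriod (by rw [hs]; exact i.val_lt)
        (by rw [hs]; exact j.val_lt)] at this
      exact ZMod.val_injective _ this
    · rintro ⟨y, hy⟩
      obtain ⟨j, hj⟩ := (by simpa using hy : φ.SameCycle x₀ y).exists_nat_pow_eq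
      refine ⟨(j : ZMod (2 * s)), Subtype.ext ?_⟩
      simp only [ZMod.val_natCast, hmod]
      rw [← hj, Equiv.Perm.coe_pow]
    · intro i j hij
      have := eq_of_sameCycle_of_nonCrossing hf hσ hlt hφ hij
        ((hmem i.val).symm.trans (hmem j.val))
      rw [Function.iterate_eq_iterate_iff_of_lt_minimalPeriod (by rw [hs]; exact i.val_lt)
        (by rw [hs]; exact j.val_lt)] at this
      exact ZMod.val_injective _ this
    · intro i
      refine Or.inl ⟨rfl, ?_⟩
      have h1 : (i + 1).val = (i.val + 1) % (2 * s) := by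
        rw [ZMod.val_add, ZMod.val_one'' (by omega)]
      simp only [h1, hmod]
      rw [Function.iterate_succ_apply', hφ, hσ]
      rfl
  let r : Setoid (Fin k) := Equiv.Perm.SameCycle.setoid φ
  let e := Fintype.equivFin (Quotient r)
  choose s hs using key
  refine ⟨_, fun i => s (e.symm i).out,
    fun i => univ.filter fun y => φ.SameCycle (e.symm i).out y, ?_, ?_, fun i => hs _⟩
  · intro i j hij
    rw [Finset.disjoint_left]
    intro y hi hj
    simp only [mem_filter, mem_univ, true_and] at hi hj
    refine hij (e.symm.injective ?_)
    rw [← Quotient.out_eq (e.symm i), ← Quotient.out_eq (e.symm j)]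
    exact Quotient.sound (hi.trans hj.symm)
  · ext y
    simp only [mem_biUnion, mem_filter, mem_univ, true_and, iff_true]
    refine ⟨e ⟦y⟧, ?_⟩
    rw [Equiv.symm_apply_apply]
    exact Quotient.mk_out (s := r) y

/-- A walk (a list of vertices) is planar-bipartite if its labels do not cross and its steps
alternate between the two colours of some 2-colouring. -/
def IsEvenNonCrossing {V : Type*} (l : List V) : Prop :=
  (∀ p q, [p, q, p, q].Sublist l → p = q) ∧ ∃ c : V → Bool, l.IsChain fun x y => c x ≠ c y

theorem sublist_of_sublist_double {V : Type*} {a : V} {L X Y : List V}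
    (hL : L.IsChain (· ≠ ·)) (hs : L.Sublist (X ++ a :: a :: Y)) : L.Sublist (X ++ a :: Y) := by
  induction X generalizing L with
  | nil =>
    rcases L with _ | ⟨b, _ | ⟨c, L⟩⟩
    · simp
    · simpa using hs
    · rw [List.isChain_cons_cons] at hL
      simp only [List.nil_append, List.cons_sublist_cons'] at hs ⊢
      grind
  | cons b X ih =>
    rcases L with _ | ⟨c, L⟩
    · simp
    · rw [List.cons_append, List.cons_sublist_cons'] at hs ⊢
      exact hs.imp (ih hL) (And.imp_right (ih hL.tail))

theorem crossing_avoids {t : ℕ} {v : Fin (t + 1)} {X Y : List (Fin t)} {p q : Fin (t + 1)}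
    (h : p ≠ q)
    (hs : [p, q, p, q].Sublist (X.map v.succAbove ++ v :: Y.map v.succAbove)) :
    ∃ p' q', p' ≠ q' ∧ [p', q', p', q'].Sublist (X ++ Y) := by
  have hc : (X.map v.succAbove ++ v :: Y.map v.succAbove).count v = 1 := by
    have h0 : ∀ Z : List (Fin t), (Z.map v.succAbove).count v = 0 := fun Z => by
      rw [List.count_eq_zero]
      simp [Fin.succAbove_ne]
    simp [h0]
  have hle := hs.count_le v
  rw [hc] at hle
  have hp : p ≠ v := by
    rintro rfl
    simp [List.count_cons] at hle
  have hq : q ≠ v := by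
    rintro rfl
    simp only [List.count_cons, List.count_nil, beq_self_eq_true, if_true] at hle
    omega
  obtain ⟨p', rfl⟩ := Fin.exists_succAbove_eq hp
  obtain ⟨q', rfl⟩ := Fin.exists_succAbove_eq hq
  refine ⟨p', q', fun h' => h (by rw [h']), ?_⟩
  have h1 := hs.filter (fun z => decide (z ≠ v))
  have h0 : ∀ Z : List (Fin t), (Z.map v.succAbove).filter (fun z => decide (z ≠ v)) =
      Z.map v.succAbove := fun Z => by
    rw [List.filter_eq_self]
    simp [Fin.succAbove_ne]
  rw [List.filter_append, List.filter_cons_of_neg (a := v) (by simp), h0, h0, ← List.map_append] at h1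
  have h2 : [v.succAbove p', v.succAbove q', v.succAbove p', v.succAbove q'].filter
      (fun z => decide (z ≠ v)) = [p', q', p', q'].map v.succAbove := by
    simp [Fin.succAbove_ne]
  rw [h2] at h1
  obtain ⟨Z, hZ, hZ'⟩ := List.sublist_map_iff.mp h1
  rwa [List.map_injective_iff.mpr Fin.succAbove_right_injective hZ']

theorem IsEvenNonCrossing.of_merge {t : ℕ} {v : Fin (t + 1)} {x : Fin t} {X Y : List (Fin t)}
    (h : IsEvenNonCrossing (X ++ x :: Y)) :
    IsEvenNonCrossing (X.map v.succAbove ++ v :: Y.map v.succAbove) := by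
  obtain ⟨hnc, c, hc⟩ := h
  constructor
  · intro p q hs
    by_contra hpq
    obtain ⟨p', q', hpq', hs'⟩ := crossing_avoids hpq hs
    exact hpq' (hnc _ _ (hs'.trans (List.Sublist.append_left (List.sublist_cons_self _ _) _)))
  · refine ⟨v.insertNth (c x) c, ?_⟩
    rw [← List.isChain_map (R := fun a b => a ≠ b) c] at hc
    rw [← List.isChain_map (R := fun a b => a ≠ b)]
    simpa [Function.comp_def] using hc

theorem IsEvenNonCrossing.of_spike {t : ℕ} {v : Fin (t + 1)} {u : Fin t} {X Y : List (Fin t)}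
    (h : IsEvenNonCrossing (X ++ u :: Y)) :
    IsEvenNonCrossing ((X ++ [u]).map v.succAbove ++ v :: (u :: Y).map v.succAbove) := by
  obtain ⟨hnc, c, hc⟩ := h
  constructor
  · intro p q hs
    by_contra hpq
    obtain ⟨p', q', hpq', hs'⟩ := crossing_avoids hpq hs
    rw [List.append_assoc] at hs'
    exact hpq' (hnc _ _ (sublist_of_sublist_double
      (by simp [hpq', hpq'.symm]) hs'))
  · refine ⟨v.insertNth (!c u) c, ?_⟩
    rw [← List.isChain_map (R := fun a b => a ≠ b) c] at hc
    rw [← List.isChain_map (R := fun a b => a ≠ b)]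
    rw [List.map_append, List.map_cons, List.isChain_split] at hc
    simp only [List.map_append, List.map_map, Function.comp_def, Fin.insertNth_apply_succAbove,
      Fin.insertNth_apply_same, List.map_cons, List.append_assoc, List.map_nil, List.cons_append,
      List.nil_append]
    rw [List.isChain_split]
    rw [List.isChain_cons_cons, List.isChain_cons_cons]
    exact ⟨hc.1, by simp, by simp, hc.2⟩

/-- The product of the entries of `S` along the steps of a walk. -/
def pathProd {V : Type*} (S : Matrix V V ℝ) : List V → ℝ
  | a :: b :: l => S a b * pathProd S (b :: l)
  | _ => 1

theorem pathProd_append {V : Type*} (S : Matrix V V ℝ) (X Y : List V) (u v : V) :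
    pathProd S (X ++ u :: v :: Y) = pathProd S (X ++ [u]) * S u v * pathProd S (v :: Y) := by
  induction X with
  | nil => simp [pathProd]
  | cons a X ih =>
    rcases X with _ | ⟨b, X⟩
    · simp [pathProd, mul_assoc]
    · simp only [List.cons_append, pathProd] at ih ⊢
      rw [ih]
      ring

theorem pathProd_append_cons {V : Type*} (S : Matrix V V ℝ) (X Y : List V) (u : V) :
    pathProd S (X ++ u :: Y) = pathProd S (X ++ [u]) * pathProd S (u :: Y) := by
  rcases Y with _ | ⟨v, Y⟩
  · simp [pathProd]
  · rw [pathProd_append, pathProd, mul_assoc]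

theorem abs_pathProd_le_one {V : Type*} {S : Matrix V V ℝ} (hS : ∀ i j, |S i j| ≤ 1)
    (l : List V) : |pathProd S l| ≤ 1 := by
  induction l with
  | nil => simp [pathProd]
  | cons a l ih =>
    rcases l with _ | ⟨b, l⟩
    · simp [pathProd]
    · rw [pathProd, abs_mul]
      exact mul_le_one₀ (hS a b) (abs_nonneg _) ih

theorem pathProd_ofFn {V : Type*} (S : Matrix V V ℝ) {k : ℕ} (f : Fin (k + 1) → V) :
    pathProd S (List.ofFn f) = ∏ i : Fin k, S (f i.castSucc) (f i.succ) := by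
  induction k with
  | zero => simp [pathProd]
  | succ k ih =>
    rw [Fin.prod_univ_succ, List.ofFn_succ, List.ofFn_succ, pathProd, ← List.ofFn_succ
      (f := fun i => f i.succ), ih]
    rfl

open Classical in
/-- The sum of `pathProd` over all injective relabellings of the walk `l`. -/
noncomputable def walkSum {t n : ℕ} (S : Matrix (Fin n) (Fin n) ℝ) (l : List (Fin t)) : ℝ :=
  ∑ φ : Fin t → Fin n with Function.Injective φ, pathProd S (l.map φ)

theorem IsConferenceMatrix.abs_le_one {n : ℕ} {S : Matrix (Fin n) (Fin n) ℝ}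
    (hS : IsConferenceMatrix S) (i j : Fin n) : |S i j| ≤ 1 := by
  by_cases h : i = j
  · simp [h, hS.2.1 j]
  · rcases hS.2.2.1 i j h with h | h <;> simp [h]

theorem IsConferenceMatrix.sum_mul {n : ℕ} {S : Matrix (Fin n) (Fin n) ℝ}
    (hS : IsConferenceMatrix S) (a b : Fin n) :
    ∑ z, S a z * S z b = if a = b then (n : ℝ) - 1 else 0 := by
  have h := congrFun (congrFun hS.2.2.2 a) b
  rw [hS.1.eq, Matrix.mul_apply] at h
  rw [h, Matrix.smul_apply, Matrix.one_apply]
  simp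

theorem abs_walkSum_le {t n : ℕ} {S : Matrix (Fin n) (Fin n) ℝ} (hS : IsConferenceMatrix S)
    (l : List (Fin t)) : |walkSum S l| ≤ (n : ℝ) ^ t := by
  classical
  calc |walkSum S l| ≤ ∑ φ : Fin t → Fin n with Function.Injective φ, |pathProd S (l.map φ)| :=
        Finset.abs_sum_le_sum_abs _ _
    _ ≤ ∑ φ : Fin t → Fin n, |pathProd S (l.map φ)| :=
        Finset.sum_le_sum_of_subset_of_nonneg (Finset.filter_subset _ _)
          fun _ _ _ => abs_nonneg _
    _ ≤ ∑ φ : Fin t → Fin n, 1 :=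
        Finset.sum_le_sum fun φ _ => abs_pathProd_le_one hS.abs_le_one _
    _ = (n : ℝ) ^ t := by simp

theorem insertNth_injective_iff {t : ℕ} {α : Type*} (v : Fin (t + 1)) (z : α) (φ : Fin t → α) :
    Function.Injective (v.insertNth z φ : Fin (t + 1) → α) ↔
      Function.Injective φ ∧ ∀ x, φ x ≠ z := by
  constructor
  · refine fun h => ⟨fun x y hxy => ?_, fun x hx => ?_⟩
    · exact Fin.succAbove_right_injective (p := v) (h (by simpa using hxy))
    · exact Fin.succAbove_ne v x (h (by simpa using hx))
  · rintro ⟨hφ, hz⟩ x y hxy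
    rcases Fin.eq_self_or_eq_succAbove v x with rfl | ⟨x, rfl⟩
    · rcases Fin.eq_self_or_eq_succAbove x y with rfl | ⟨y, rfl⟩
      · rfl
      · exact absurd (by simpa using hxy.symm) (hz y)
    · rcases Fin.eq_self_or_eq_succAbove v y with rfl | ⟨y, rfl⟩
      · exact absurd (by simpa using hxy) (hz x)
      · exact congrArg _ (hφ (by simpa using hxy))

/-- Summing out a vertex visited once. -/
theorem walkSum_eq {t n : ℕ} {S : Matrix (Fin n) (Fin n) ℝ} (hS : IsConferenceMatrix S)
    (v : Fin (t + 1)) (X Y : List (Fin t)) (u w : Fin t) :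
    walkSum S ((X ++ [u]).map v.succAbove ++ v :: (w :: Y).map v.succAbove) =
      (if u = w then ((n : ℝ) - 1) * walkSum S (X ++ u :: Y) else 0) -
        ∑ x : Fin t, walkSum S ((X ++ [u]) ++ x :: w :: Y) := by
  classical
  have hprod : ∀ (φ : Fin t → Fin n) (z : Fin n),
      pathProd S (((X ++ [u]).map φ) ++ z :: (w :: Y).map φ) =
        pathProd S ((X ++ [u]).map φ) * pathProd S ((w :: Y).map φ) *
          (S (φ u) z * S z (φ w)) := by
    intro φ z
    rw [List.map_append, List.append_assoc, List.map_singleton, List.singleton_append,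
      pathProd_append, List.map_cons, pathProd]
    ring
  have hins : ∀ (φ : Fin t → Fin n) (z : Fin n),
      ((X ++ [u]).map v.succAbove ++ v :: (w :: Y).map v.succAbove).map
        (v.insertNth z φ : Fin (t + 1) → Fin n) =
          (X ++ [u]).map φ ++ z :: (w :: Y).map φ := by
    intro φ z
    simp [Function.comp_def]
  have hlast : (if u = w then ((n : ℝ) - 1) * walkSum S (X ++ u :: Y) else 0) =
      ∑ φ : Fin t → Fin n with Function.Injective φ,
        pathProd S ((X ++ [u]).map φ) * pathProd S ((w :: Y).map φ) *
          ∑ z, S (φ u) z * S z (φ w) := by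
    split_ifs with h
    · subst h
      rw [walkSum, Finset.mul_sum]
      refine Finset.sum_congr rfl fun φ _ => ?_
      rw [hS.sum_mul, if_pos rfl, List.map_append, List.map_cons, pathProd_append_cons]
      simp only [List.map_append, List.map_cons, List.map_nil]
      ring
    · refine (Finset.sum_eq_zero fun φ hφ => ?_).symm
      rw [hS.sum_mul, if_neg, mul_zero]
      exact fun h' => h ((Finset.mem_filter.mp hφ).2 h')
  rw [hlast]
  have hmerge : ∀ (φ : Fin t → Fin n) (x : Fin t),
      ((X ++ [u]) ++ x :: w :: Y).map φ = (X ++ [u]).map φ ++ φ x :: (w :: Y).map φ :=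
    fun φ x => by rw [List.map_append (l₁ := X ++ [u]), List.map_cons]
  simp only [walkSum, hmerge, hprod]
  rw [Finset.sum_comm, ← Finset.sum_sub_distrib, Finset.sum_filter,
    ← (Fin.insertNthEquiv (fun _ => Fin n) v).sum_comp, Fintype.sum_prod_type_right,
    Finset.sum_filter]
  refine Finset.sum_congr rfl fun φ _ => ?_
  have hequiv : ∀ z, Fin.insertNthEquiv (fun _ => Fin n) v (z, φ) = v.insertNth z φ :=
    fun _ => rfl
  simp only [hequiv, insertNth_injective_iff, hins, hprod]
  by_cases hφ : Function.Injective φ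
  · simp only [hφ, true_and, if_true]
    rw [← Finset.mul_sum, ← mul_sub, ← Finset.sum_filter, ← Finset.mul_sum]
    congr 1
    rw [eq_sub_iff_add_eq, ← Finset.sum_image (s := Finset.univ) (g := φ)
      (f := fun z => S (φ u) z * S z (φ w)) fun x _ y _ h => hφ h]
    convert Finset.sum_filter_add_sum_filter_not Finset.univ (fun z => ∀ x, φ x ≠ z)
      (fun z => S (φ u) z * S z (φ w)) using 3
    ext z
    simp
  · simp [hφ]

theorem two_mul_le_length {t : ℕ} {l : List (Fin t)} (h : ∀ v, 2 ≤ l.count v) :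
    2 * t ≤ l.length := by
  classical
  calc 2 * t = ∑ _v : Fin t, 2 := by simp [mul_comm]
    _ ≤ ∑ v : Fin t, l.count v := Finset.sum_le_sum fun v _ => h v
    _ = l.length := by
      simpa using Multiset.sum_count_eq_card (s := Finset.univ) (m := (l : Multiset (Fin t)))
        (by simp)

theorem head?_eq_getLast?_append_cons_iff {V : Type*} {X Y : List V} (x : V) (hX : X ≠ [])
    (hY : Y ≠ []) : (X ++ x :: Y).head? = (X ++ x :: Y).getLast? ↔ X.head? = Y.getLast? := by
  rw [List.head?_append_of_ne_nil _ hX, List.getLast?_append_of_ne_nil _ (by simp)]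
  obtain ⟨y, Y, rfl⟩ := List.exists_cons_of_ne_nil hY
  rw [List.getLast?_cons_cons]

theorem rpow_isLittleO_rpow {a b : ℝ} (h : a < b) :
    (fun x : ℝ => x ^ a) =o[atTop] fun x : ℝ => x ^ b := by
  have hpos : ∀ᶠ x : ℝ in atTop, 0 < x := eventually_gt_atTop 0
  rw [Asymptotics.isLittleO_iff_tendsto' (hpos.mono fun x hx h0 =>
    absurd h0 (Real.rpow_pos_of_pos hx b).ne')]
  refine (tendsto_rpow_neg_atTop (sub_pos.mpr h)).congr' (hpos.mono fun x hx => ?_)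
  simp only [← Real.rpow_sub hx, neg_sub]

/-- A closed walk that is not planar-bipartite has negligible injective sum. -/
theorem walkSum_isLittleO {n : ℕ → ℕ} (hn : Tendsto n atTop atTop)
    {S : ∀ i, Matrix (Fin (n i)) (Fin (n i)) ℝ} (hS : ∀ i, IsConferenceMatrix (S i)) {t : ℕ}
    (l : List (Fin t)) (hclosed : l.head? = l.getLast?) (hsurj : ∀ v, v ∈ l)
    (hl : ¬ IsEvenNonCrossing l) :
    (fun i => walkSum (S i) l) =o[atTop]
      fun i => (n i : ℝ) ^ (((l.length : ℝ) + 1) / 2) := by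
  classical
  have hn' : Tendsto (fun i => (n i : ℝ)) atTop atTop := tendsto_natCast_atTop_atTop.comp hn
  induction t with
  | zero =>
    rcases l with _ | ⟨a, l⟩
    · exact absurd ⟨by simp, fun _ => true, by simp⟩ hl
    · exact a.elim0
  | succ t ih =>
    by_cases hcount : ∀ v, 2 ≤ l.count v
    · have h1 : (fun i => walkSum (S i) l) =O[atTop] fun i => (n i : ℝ) ^ ((t + 1 : ℕ) : ℝ) :=
        Asymptotics.IsBigO.of_bound 1 (Eventually.of_forall fun i => by
          rw [Real.rpow_natCast, one_mul, Real.norm_eq_abs, Real.norm_eq_abs,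
            abs_of_nonneg (by positivity : (0 : ℝ) ≤ (n i : ℝ) ^ (t + 1))]
          exact abs_walkSum_le (hS i) l)
      refine h1.trans_isLittleO ((rpow_isLittleO_rpow ?_).comp_tendsto hn')
      have : ((2 * (t + 1) : ℕ) : ℝ) ≤ l.length := Nat.cast_le.mpr (two_mul_le_length hcount)
      push_cast at this ⊢
      linarith
    · push Not at hcount
      obtain ⟨v, hv⟩ := hcount
      obtain ⟨X, Y, rfl⟩ := List.append_of_mem (hsurj v)
      have hvX : v ∉ X := by
        rw [← List.count_eq_zero]
        simp at hv; omega
      have hvY : v ∉ Y := by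
        rw [← List.count_eq_zero]
        simp at hv; omega
      have hpre : ∀ Z : List (Fin (t + 1)), v ∉ Z → ∃ Z' : List (Fin t), Z = Z'.map v.succAbove := by
        intro Z hZ
        have : Z ∈ Set.range (List.map v.succAbove) := by
          rw [Set.range_list_map]
          intro x hx
          exact Fin.exists_succAbove_eq fun h => hZ (h ▸ hx)
        obtain ⟨Z', hZ'⟩ := this
        exact ⟨Z', hZ'.symm⟩
      obtain ⟨X, rfl⟩ := hpre X hvX
      obtain ⟨Y, rfl⟩ := hpre Y hvY
      rcases List.eq_nil_or_concat' X with rfl | ⟨X, u, rfl⟩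
      · rcases List.eq_nil_or_concat' Y with rfl | ⟨Y, w, rfl⟩
        · exact absurd ⟨by simp, fun _ => true, by simp⟩ hl
        · simp [List.getLast?_cons, (Fin.succAbove_ne _ _).symm] at hclosed
      rcases Y with _ | ⟨w, Y⟩
      · rw [List.head?_append_of_ne_nil _ (by simp), List.getLast?_append_of_ne_nil _ (by simp),
          List.head?_map] at hclosed
        obtain ⟨y, -, hy⟩ := Option.map_eq_some_iff.mp hclosed
        exact absurd hy (Fin.succAbove_ne v y)
      rw [head?_eq_getLast?_append_cons_iff v (by simp) (by simp), List.head?_map,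
        List.getLast?_map] at hclosed
      replace hclosed := Option.map_injective Fin.succAbove_right_injective hclosed
      have hmem : ∀ x, x ∈ X ++ [u] ∨ x ∈ w :: Y := by
        intro x
        have := hsurj (v.succAbove x)
        rw [List.mem_append, List.mem_cons] at this
        simpa [Fin.succAbove_ne] using this
      have hlen : (((X ++ [u]).map v.succAbove ++ v :: (w :: Y).map v.succAbove).length : ℝ) =
          (X.length : ℝ) + Y.length + 3 := by
        simp; ring
      rw [hlen]
      simp only [walkSum_eq (hS _)]
      refine Asymptotics.IsLittleO.sub ?_ (Asymptotics.IsLittleO.fun_sum fun x _ => ?_)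
      · split_ifs with huw
        · subst huw
          have h1 := ih (X ++ u :: Y)
            (by rw [List.getLast?_append_of_ne_nil _ (by simp)]; cases X <;> exact hclosed)
            (fun x => by have := hmem x; simp at this ⊢; tauto) fun h => hl h.of_spike
          have h2 : (fun i => (n i : ℝ) - 1) =O[atTop] fun i => (n i : ℝ) :=
            Asymptotics.IsBigO.of_bound 1 ((hn'.eventually_ge_atTop 1).mono fun i hi => by
              rw [Real.norm_eq_abs, Real.norm_eq_abs, abs_of_nonneg (by linarith),
                abs_of_nonneg (by linarith)]
              linarith)
          refine (h2.mul_isLittleO h1).congr' EventuallyEq.rfl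
            ((hn'.eventually_gt_atTop 0).mono fun i hi => ?_)
          simp only
          nth_rw 1 [← Real.rpow_one (n i : ℝ)]
          rw [← Real.rpow_add hi]
          congr 1
          simp
          ring
        · exact Asymptotics.isLittleO_zero _ _
      · have h1 := ih (X ++ [u] ++ x :: w :: Y) 
          ((head?_eq_getLast?_append_cons_iff x (by simp) (by simp)).mpr hclosed)
          (fun y => by have := hmem y; simp at this ⊢; tauto) fun h => hl h.of_merge
        have hlen' : ((X ++ [u] ++ x :: w :: Y).length : ℝ) =
            (X.length : ℝ) + Y.length + 3 := by
          simp; ring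
        rwa [hlen'] at h1

theorem part_mem_and_mem {k : ℕ} {π : Finset (Finset (Fin k))} (hπ : IsPartitionOf k π)
    (i : Fin k) : part π i ∈ π ∧ i ∈ part π i := by
  obtain ⟨B, ⟨hB, hi⟩, huniq⟩ := hπ.2 i
  have : part π i = B := by
    ext j
    simp only [part, mem_filter, mem_univ, true_and]
    refine ⟨fun h => (h B hB).mp hi, fun hj C hC => ⟨fun hiC => ?_, fun hjC => ?_⟩⟩
    · rwa [huniq C ⟨hC, hiC⟩]
    · obtain ⟨D, -, hD⟩ := hπ.2 j
      rwa [hD C ⟨hC, hjC⟩, ← hD B ⟨hB, hj⟩]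
  rw [this]
  exact ⟨hB, hi⟩

theorem part_eq_of_mem {k : ℕ} {π : Finset (Finset (Fin k))} (hπ : IsPartitionOf k π)
    {i : Fin k} {B : Finset (Fin k)} (hB : B ∈ π) (hi : i ∈ B) : part π i = B :=
  (hπ.2 i).unique (part_mem_and_mem hπ i) ⟨hB, hi⟩

theorem levelSets_eq_iff {k n : ℕ} {π : Finset (Finset (Fin k))} (hπ : IsPartitionOf k π)
    (a : Fin k → Fin n) :
    levelSets a = π ↔ ∀ i j, a i = a j ↔ part π i = part π j := by
  constructor
  · intro h i j
    have hp : ∀ i, part π i = univ.filter fun j => a j = a i := fun i =>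
      part_eq_of_mem hπ (by rw [← h]; exact mem_image_of_mem _ (mem_univ i)) (by simp)
    rw [hp, hp]
    constructor
    · intro h'
      rw [h']
    · intro h'
      have : i ∈ univ.filter fun x => a x = a j := by rw [← h']; simp
      simpa using this
  · intro h
    have hp : ∀ i, (univ.filter fun j => a j = a i) = part π i := by
      intro i
      ext j
      simp only [mem_filter, mem_univ, true_and, h]
      constructor
      · intro h'
        rw [← h']
        exact (part_mem_and_mem hπ j).2
      · intro h'
        exact part_eq_of_mem hπ (part_mem_and_mem hπ i).1 h'
    ext B
    simp only [levelSets, hp, mem_image, mem_univ, true_and]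
    constructor
    · rintro ⟨i, rfl⟩
      exact (part_mem_and_mem hπ i).1
    · intro hB
      obtain ⟨i, hi⟩ := Finset.nonempty_iff_ne_empty.mpr fun h0 => hπ.1 (h0 ▸ hB)
      exact ⟨i, part_eq_of_mem hπ hB hi⟩

theorem exists_labelling {k : ℕ} {π : Finset (Finset (Fin k))} (hπ : IsPartitionOf k π) :
    ∃ f : Fin k → Fin π.card, Function.Surjective f ∧ ∀ i j, f i = f j ↔ part π i = part π j := by
  refine ⟨fun i => π.equivFin ⟨part π i, (part_mem_and_mem hπ i).1⟩, fun x => ?_, fun i j => ?_⟩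
  · obtain ⟨⟨B, hB⟩, rfl⟩ := π.equivFin.surjective x
    obtain ⟨i, hi⟩ := Finset.nonempty_iff_ne_empty.mpr fun h0 => hπ.1 (h0 ▸ hB)
    exact ⟨i, by simp [part_eq_of_mem hπ hB hi]⟩
  · simp

/-- The closed walk `f 0, f 1, …, f (k - 1), f 0`. -/
def closedWalk {k : ℕ} {V : Type*} (hk : 0 < k) (f : Fin k → V) : List V :=
  List.ofFn fun i : Fin (k + 1) => f ⟨i.val % k, Nat.mod_lt _ hk⟩

theorem length_closedWalk {k : ℕ} {V : Type*} (hk : 0 < k) (f : Fin k → V) :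
    (closedWalk hk f).length = k + 1 := by simp [closedWalk]

theorem map_closedWalk {k : ℕ} {V W : Type*} (hk : 0 < k) (f : Fin k → V) (g : V → W) :
    (closedWalk hk f).map g = closedWalk hk (g ∘ f) := by
  simp [closedWalk, List.map_ofFn, Function.comp_def]

theorem pathProd_closedWalk {k n : ℕ} (hk : 0 < k) (S : Matrix (Fin n) (Fin n) ℝ)
    (a : Fin k → Fin n) : pathProd S (closedWalk hk a) = Delta S a := by
  rw [closedWalk, pathProd_ofFn, Delta]
  refine Finset.prod_congr rfl fun i _ => ?_
  congr 2
  exact Fin.ext (Nat.mod_eq_of_lt i.2)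

theorem head?_closedWalk {k : ℕ} {V : Type*} (hk : 0 < k) (f : Fin k → V) :
    (closedWalk hk f).head? = (closedWalk hk f).getLast? := by
  rw [List.head?_eq_getElem?, List.getLast?_eq_getElem?, length_closedWalk,
    Nat.add_sub_cancel, closedWalk, List.getElem?_ofFn, List.getElem?_ofFn]
  simp

theorem mem_closedWalk {k : ℕ} {V : Type*} (hk : 0 < k) (f : Fin k → V) (i : Fin k) :
    f i ∈ closedWalk hk f := by
  rw [closedWalk, List.mem_ofFn]
  exact ⟨i.castSucc, congrArg f (Fin.ext (Nat.mod_eq_of_lt i.2))⟩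

theorem sublist_closedWalk {k : ℕ} {V : Type*} (hk : 0 < k) (f : Fin k → V) {a b c d : Fin k}
    (hab : a < b) (hbc : b < c) (hcd : c < d) :
    [f a, f b, f c, f d].Sublist (closedWalk hk f) := by
  have h1 : ([a, b, c, d] : List (Fin k)).Sublist (List.finRange k) := by
    refine List.sublist_of_subperm_of_pairwise (r := (· < ·)) ?_ ?_ ?_
    · exact List.subperm_of_subset (by simp; omega) fun x _ => List.mem_finRange x
    · simp; omega
    · exact List.pairwise_lt_finRange k
  have h2 := h1.map f
  rw [← List.ofFn_eq_map] at h2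
  refine h2.trans ?_
  rw [closedWalk, List.ofFn_succ_last]
  convert List.sublist_append_left _ _ using 2
  exact congrArg List.ofFn (funext fun i => congrArg f (Fin.ext (Nat.mod_eq_of_lt i.2)))

theorem isChain_closedWalk {k : ℕ} {V : Type*} (hk : 0 < k) {f : Fin k → V} {R : V → V → Prop}
    (h : (closedWalk hk f).IsChain R) (i : Fin k) : R (f i) (f (cyc i)) := by
  rw [closedWalk, List.isChain_iff_getElem] at h
  have := h i (by simp)
  simp only [List.getElem_ofFn] at this
  rwa [show (⟨i.val % k, Nat.mod_lt _ hk⟩ : Fin k) = i from Fin.ext (Nat.mod_eq_of_lt i.2)] at this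

theorem inEC_of_isEvenNonCrossing {k : ℕ} {V : Type*} (hk : 0 < k)
    {π : Finset (Finset (Fin k))} (hπ : IsPartitionOf k π) {f : Fin k → V}
    (hf : ∀ i j, f i = f j ↔ part π i = part π j)
    (h : IsEvenNonCrossing (closedWalk hk f)) : InEC k π.card π := by
  obtain ⟨hnc, c, hc⟩ := h
  have hcross : ∀ a₁ b₁ a₂ b₂ : Fin k, a₁ < b₁ → b₁ < a₂ → a₂ < b₂ → part π a₁ = part π a₂ →
      part π b₁ = part π b₂ → part π a₁ = part π b₁ := by
    intro a₁ b₁ a₂ b₂ h1 h2 h3 ha hb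
    have hs := sublist_closedWalk hk f h1 h2 h3
    rw [← (hf _ _).mpr ha, ← (hf _ _).mpr hb] at hs
    exact (hf _ _).mp (hnc _ _ hs)
  refine ⟨hπ, rfl, ?_, exists_evenCycles hcross (c := c ∘ f)
    (fun x y hxy => congrArg c ((hf x y).mpr hxy)) fun x => isChain_closedWalk hk hc x⟩
  rintro ⟨A, hA, B, hB, hAB, a₁, ha₁, a₂, ha₂, b₁, hb₁, b₂, hb₂, h1, h2, h3⟩
  have := hcross a₁ b₁ a₂ b₂ h1 h2 h3
  rw [part_eq_of_mem hπ hA ha₁, part_eq_of_mem hπ hA ha₂, part_eq_of_mem hπ hB hb₁,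
    part_eq_of_mem hπ hB hb₂] at this
  exact hAB (this rfl rfl)

theorem sum_Ln_eq_walkSum {k n t : ℕ} (hk : 0 < k) {π : Finset (Finset (Fin k))}
    (hπ : IsPartitionOf k π) {f : Fin k → Fin t} (hsurj : Function.Surjective f)
    (hf : ∀ i j, f i = f j ↔ part π i = part π j) (S : Matrix (Fin n) (Fin n) ℝ) :
    ∑ a ∈ Ln n π, Delta S a = walkSum S (closedWalk hk f) := by
  classical
  rw [walkSum]
  refine (Finset.sum_bij' (fun φ _ => φ ∘ f) (fun a _ => a ∘ Function.surjInv hsurj)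
    ?_ ?_ ?_ ?_ ?_).symm
  · intro φ hφ
    rw [Ln, mem_filter, levelSets_eq_iff hπ]
    exact ⟨mem_univ _, fun i j => (mem_filter.mp hφ).2.eq_iff.trans (hf i j)⟩
  · intro a ha
    rw [Ln, mem_filter, levelSets_eq_iff hπ] at ha
    rw [mem_filter]
    refine ⟨mem_univ _, fun x y hxy => ?_⟩
    have := (hf _ _).mpr ((ha.2 _ _).mp hxy)
    rwa [Function.surjInv_eq hsurj, Function.surjInv_eq hsurj] at this
  · intro φ _
    ext x
    simp [Function.surjInv_eq]
  · intro a ha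
    rw [Ln, mem_filter, levelSets_eq_iff hπ] at ha
    funext i
    exact (ha.2 _ _).mpr ((hf _ _).mp (Function.surjInv_eq hsurj (f i)))
  · intro φ _
    rw [map_closedWalk, pathProd_closedWalk]

/-- If `π ∈ Π(k,t) \ EC(k,t)`, then `V_n(π) → 0` along any sequence of
symmetric conference matrices of increasing sizes. -/
theorem stmt7 (k t : ℕ) (π : Finset (Finset (Fin k)))
    (hπ : IsPartitionOf k π) (hcard : π.card = t) (hnotEC : ¬ InEC k t π)
    (n : ℕ → ℕ) (hmono : StrictMono n)
    (S : ∀ i, Matrix (Fin (n i)) (Fin (n i)) ℝ)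
    (hS : ∀ i, IsConferenceMatrix (S i)) :
    Tendsto (fun i => Vn (n i) (S i) π) atTop (nhds 0) := by
  rcases Nat.eq_zero_or_pos k with rfl | hk
  · refine absurd ⟨hπ, hcard, ?_, 0, fun _ => 0, fun _ => ∅, fun i => i.elim0, by ext i; exact i.elim0,
      fun i => i.elim0⟩ hnotEC
    rintro ⟨-, -, -, -, -, a, -⟩
    exact a.elim0
  · subst hcard
    obtain ⟨f, hsurj, hf⟩ := exists_labelling hπ
    have h := walkSum_isLittleO hmono.tendsto_atTop hS (closedWalk hk f) (head?_closedWalk hk f)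
      (fun v => by obtain ⟨i, rfl⟩ := hsurj v; exact mem_closedWalk hk f i)
      fun h => hnotEC (inEC_of_isEvenNonCrossing hk hπ hf h)
    refine h.tendsto_div_nhds_zero.congr fun i => ?_
    rw [Vn, sum_Ln_eq_walkSum hk hπ hsurj hf, length_closedWalk]
    congr 2
    push_cast
    ring
end

section
/- Fix k, n ∈ ℕ and let F be a real n×n matrix with FᵀF = I + (1/√n) S for some n×n symmetric conference matrix S. Define f : {x ∈ ℝⁿ : ‖x‖_∞ < 2} → ℝ by f(x) := ‖F diag(x)‖_{S^{2k}}^{2k} = tr( (diag(x) Fᵀ F diag(x))^k ). Then f is convex, and f is (8^k k n^{1 − 1/(2k)})-Lipschitz with respect to the Euclidean norm on its domain. -/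
open MeasureTheory ProbabilityTheory Filter Finset
open scoped ENNReal

section TraceInequalities

open Matrix

lemma gram_conj_apply {ι : Type*} [Fintype ι] (Z V : Matrix ι ι ℝ) (i : ι) :
    (Vᵀ * (Zᵀ * Z) * V) i i = ∑ l, (Z * V) l i ^ 2 := by
  have : Vᵀ * (Zᵀ * Z) * V = (Z * V)ᵀ * (Z * V) := by
    rw [transpose_mul]
    simp only [Matrix.mul_assoc]
  rw [this, Matrix.mul_apply]
  simp [sq]

variable {ι : Type*} [Fintype ι] [DecidableEq ι]

lemma exists_orthogonal_diagonalization (Z : Matrix ι ι ℝ) :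
    ∃ (U : Matrix ι ι ℝ) (lam : ι → ℝ), U * Uᵀ = 1 ∧ Uᵀ * U = 1 ∧ (∀ i, 0 ≤ lam i) ∧
      Zᵀ * Z = U * diagonal lam * Uᵀ := by
  have hpsd : (Zᵀ * Z).PosSemidef := by
    simpa using posSemidef_conjTranspose_mul_self Z
  have hH := hpsd.isHermitian
  refine ⟨hH.eigenvectorUnitary, hH.eigenvalues, ?_, ?_, hpsd.eigenvalues_nonneg, ?_⟩
  · simpa [star_eq_conjTranspose] using Unitary.coe_mul_star_self hH.eigenvectorUnitary
  · simpa [star_eq_conjTranspose] using Unitary.coe_star_mul_self hH.eigenvectorUnitary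
  · have h := hH.spectral_theorem
    rw [Unitary.conjStarAlgAut_apply, star_eq_conjTranspose,
      conjTranspose_eq_transpose_of_trivial] at h
    exact h

lemma conj_diagonal_pow {U : Matrix ι ι ℝ} (hU : Uᵀ * U = 1) (lam : ι → ℝ) (k : ℕ)
    (hU' : U * Uᵀ = 1) :
    (U * diagonal lam * Uᵀ) ^ k = U * diagonal (fun i => lam i ^ k) * Uᵀ := by
  induction k with
  | zero => simp [hU']
  | succ k ih =>
    rw [pow_succ, ih]
    calc U * diagonal (fun i => lam i ^ k) * Uᵀ * (U * diagonal lam * Uᵀ)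
        = U * (diagonal (fun i => lam i ^ k) * (Uᵀ * U) * diagonal lam) * Uᵀ := by
          simp only [Matrix.mul_assoc]
      _ = _ := by simp [hU, pow_succ]

lemma trace_conj_diagonal_pow {U : Matrix ι ι ℝ} (hU : Uᵀ * U = 1) (hU' : U * Uᵀ = 1)
    (lam : ι → ℝ) (k : ℕ) :
    trace ((U * diagonal lam * Uᵀ) ^ k) = ∑ i, lam i ^ k := by
  rw [conj_diagonal_pow hU lam k hU', trace_mul_comm, ← Matrix.mul_assoc, hU, Matrix.one_mul,
    trace_diagonal]

/-- The Peierls inequality for powers of a Gram matrix. -/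
lemma sum_diag_pow_le_trace_pow (Z V : Matrix ι ι ℝ) (hV : V * Vᵀ = 1) (hV' : Vᵀ * V = 1)
    (k : ℕ) : ∑ i, ((Vᵀ * (Zᵀ * Z) * V) i i) ^ k ≤ trace ((Zᵀ * Z) ^ k) := by
  obtain ⟨U, lam, hU, hU', hlam, hZ⟩ := exists_orthogonal_diagonalization Z
  rw [hZ, trace_conj_diagonal_pow hU' hU]
  set W := Vᵀ * U with hW
  have hWW : W * Wᵀ = 1 := by
    rw [hW, transpose_mul, transpose_transpose, Matrix.mul_assoc, ← Matrix.mul_assoc U, hU,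
      Matrix.one_mul, hV']
  have hWW' : Wᵀ * W = 1 := by
    rw [hW, transpose_mul, transpose_transpose, Matrix.mul_assoc, ← Matrix.mul_assoc V, hV,
      Matrix.one_mul, hU']
  have hrow : ∀ i, ∑ j, W i j ^ 2 = 1 := fun i => by
    have := congrFun (congrFun hWW i) i
    simpa [Matrix.mul_apply, sq] using this
  have hcol : ∀ j, ∑ i, W i j ^ 2 = 1 := fun j => by
    have := congrFun (congrFun hWW' j) j
    simpa [Matrix.mul_apply, sq] using this
  have hentry : ∀ i, (Vᵀ * (U * diagonal lam * Uᵀ) * V) i i = ∑ j, W i j ^ 2 * lam j := by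
    intro i
    have : Vᵀ * (U * diagonal lam * Uᵀ) * V = W * diagonal lam * Wᵀ := by
      rw [hW, transpose_mul, transpose_transpose]
      simp only [Matrix.mul_assoc]
    rw [this, Matrix.mul_apply]
    refine Finset.sum_congr rfl fun j _ => ?_
    rw [mul_diagonal, transpose_apply]
    ring
  calc ∑ i, ((Vᵀ * (U * diagonal lam * Uᵀ) * V) i i) ^ k
      = ∑ i, (∑ j, W i j ^ 2 * lam j) ^ k := by simp only [hentry]
    _ ≤ ∑ i, ∑ j, W i j ^ 2 * lam j ^ k := Finset.sum_le_sum fun i _ =>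
        Real.pow_arith_mean_le_arith_mean_pow _ _ _ (fun j _ => sq_nonneg _) (hrow i)
          (fun j _ => hlam j) k
    _ = ∑ j, lam j ^ k := by
        rw [Finset.sum_comm]
        simp only [← Finset.sum_mul, hcol, one_mul]

/-- The `2k`-th power of the Schatten `2k`-norm is convex. -/
lemma convexOn_trace_gram_pow (k : ℕ) :
    ConvexOn ℝ Set.univ fun Z : Matrix ι ι ℝ => trace ((Zᵀ * Z) ^ k) := by
  refine ⟨convex_univ, fun X _ Y _ a b ha hb hab => ?_⟩
  obtain ⟨V, lam, hV, hV', -, hZ⟩ := exists_orthogonal_diagonalization (a • X + b • Y)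
  have hmid : trace (((a • X + b • Y)ᵀ * (a • X + b • Y)) ^ k)
      = ∑ i, (∑ l, ((a • X + b • Y) * V) l i ^ 2) ^ k := by
    simp only [← gram_conj_apply]
    rw [hZ, trace_conj_diagonal_pow hV' hV]
    have : Vᵀ * (V * diagonal lam * Vᵀ) * V = diagonal lam := by
      calc Vᵀ * (V * diagonal lam * Vᵀ) * V = (Vᵀ * V) * diagonal lam * (Vᵀ * V) := by
            simp only [Matrix.mul_assoc]
        _ = _ := by simp [hV']
    simp [this]
  have hX := sum_diag_pow_le_trace_pow X V hV hV' k
  have hY := sum_diag_pow_le_trace_pow Y V hV hV' k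
  simp only [gram_conj_apply] at hX hY
  have hnn : ∀ (Z : Matrix ι ι ℝ) i, 0 ≤ ∑ l, (Z * V) l i ^ 2 :=
    fun Z i => Finset.sum_nonneg fun l _ => sq_nonneg _
  have hsq : ∀ i, ∑ l, ((a • X + b • Y) * V) l i ^ 2
      ≤ a * ∑ l, (X * V) l i ^ 2 + b * ∑ l, (Y * V) l i ^ 2 := by
    intro i
    rw [Finset.mul_sum, Finset.mul_sum, ← Finset.sum_add_distrib]
    refine Finset.sum_le_sum fun l _ => ?_
    have := (even_two.convexOn_pow (𝕜 := ℝ)).2 (Set.mem_univ ((X * V) l i))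
      (Set.mem_univ ((Y * V) l i)) ha hb hab
    simpa [Matrix.add_mul] using this
  have hpow : ∀ i, (∑ l, ((a • X + b • Y) * V) l i ^ 2) ^ k
      ≤ a * (∑ l, (X * V) l i ^ 2) ^ k + b * (∑ l, (Y * V) l i ^ 2) ^ k := fun i =>
    (pow_le_pow_left₀ (hnn _ i) (hsq i) k).trans
      (by simpa using (convexOn_pow (𝕜 := ℝ) k).2 (hnn X i) (hnn Y i) ha hb hab)
  calc trace (((a • X + b • Y)ᵀ * (a • X + b • Y)) ^ k)
      = ∑ i, (∑ l, ((a • X + b • Y) * V) l i ^ 2) ^ k := hmid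
    _ ≤ ∑ i, (a * (∑ l, (X * V) l i ^ 2) ^ k + b * (∑ l, (Y * V) l i ^ 2) ^ k) :=
        Finset.sum_le_sum fun i _ => hpow i
    _ = a * ∑ i, (∑ l, (X * V) l i ^ 2) ^ k + b * ∑ i, (∑ l, (Y * V) l i ^ 2) ^ k := by
        rw [Finset.sum_add_distrib, Finset.mul_sum, Finset.mul_sum]
    _ ≤ a * trace ((Xᵀ * X) ^ k) + b * trace ((Yᵀ * Y) ^ k) := by gcongr
    _ = _ := by simp

lemma trace_mul_pow_comm (P Q : Matrix ι ι ℝ) (k : ℕ) :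
    trace ((P * Q) ^ k) = trace ((Q * P) ^ k) := by
  cases k with
  | zero => simp
  | succ k =>
    rw [pow_succ, ← Matrix.mul_assoc, mul_pow_mul, Matrix.mul_assoc, trace_mul_comm,
      Matrix.mul_assoc, ← pow_succ]

open scoped Matrix.Norms.L2Operator

lemma abs_entry_le_l2_opNorm (M : Matrix ι ι ℝ) (i j : ι) : |M i j| ≤ ‖M‖ := by
  have h := M.l2_opNorm_mulVec (EuclideanSpace.single j 1)
  rw [PiLp.norm_single, norm_one, mul_one] at h
  refine le_trans ?_ h
  have h2 := PiLp.norm_apply_le (WithLp.toLp 2 (M *ᵥ Pi.single j (1 : ℝ))) i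
  simpa using h2

lemma abs_trace_mul_diagonal_le (M : Matrix ι ι ℝ) (d : ι → ℝ) :
    |trace (M * diagonal d)| ≤ ‖M‖ * ∑ i, |d i| := by
  rw [trace, Finset.mul_sum]
  refine (Finset.abs_sum_le_sum_abs _ _).trans (Finset.sum_le_sum fun i _ => ?_)
  rw [diag_apply, mul_diagonal, abs_mul]
  exact mul_le_mul_of_nonneg_right (abs_entry_le_l2_opNorm M i i) (abs_nonneg _)

lemma l2_opNorm_pow_le [Nonempty ι] {A : Matrix ι ι ℝ} {R : ℝ} (hA : ‖A‖ ≤ R) (k : ℕ) :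
    ‖A ^ k‖ ≤ R ^ k :=
  (norm_pow_le A k).trans (pow_le_pow_left₀ (norm_nonneg _) hA k)

lemma abs_trace_pow_sub_pow_mul_le [Nonempty ι] {A B : Matrix ι ι ℝ} {R c : ℝ} (hc : 0 ≤ c)
    (hA : ‖A‖ ≤ R) (hB : ‖B‖ ≤ R) (hAB : ∀ N, |trace (N * (A - B))| ≤ c * ‖N‖) (k : ℕ)
    (N : Matrix ι ι ℝ) : R * |trace ((A ^ k - B ^ k) * N)| ≤ k * R ^ k * c * ‖N‖ := by
  have hR : 0 ≤ R := (norm_nonneg A).trans hA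
  induction k generalizing N with
  | zero => simp
  | succ k ih =>
    have hsplit : trace ((A ^ (k + 1) - B ^ (k + 1)) * N)
        = trace ((A ^ k - B ^ k) * (A * N)) + trace ((N * B ^ k) * (A - B)) := by
      rw [Matrix.mul_assoc N, trace_mul_comm N, ← trace_add]
      congr 1
      simp only [pow_succ]
      noncomm_ring
    have h1 := ih (A * N)
    have hAN : ‖A * N‖ ≤ R * ‖N‖ := (norm_mul_le _ _).trans (by gcongr)
    have h2 := hAB (N * B ^ k)
    have hNB : ‖N * B ^ k‖ ≤ ‖N‖ * R ^ k :=
      (norm_mul_le _ _).trans (by gcongr; exact l2_opNorm_pow_le hB k)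
    rw [hsplit]
    calc R * |trace ((A ^ k - B ^ k) * (A * N)) + trace ((N * B ^ k) * (A - B))|
        ≤ R * |trace ((A ^ k - B ^ k) * (A * N))| + R * |trace ((N * B ^ k) * (A - B))| := by
          rw [← mul_add]
          exact mul_le_mul_of_nonneg_left (abs_add_le _ _) hR
      _ ≤ k * R ^ k * c * (R * ‖N‖) + R * (c * (‖N‖ * R ^ k)) := by
          refine add_le_add (h1.trans (by gcongr)) ?_
          exact mul_le_mul_of_nonneg_left (h2.trans (by gcongr)) hR
      _ = _ := by push_cast; ring

lemma l2_opNorm_transpose (M : Matrix ι ι ℝ) : ‖Mᵀ‖ = ‖M‖ := by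
  simpa using l2_opNorm_conjTranspose M

lemma l2_opNorm_transpose_mul_self (M : Matrix ι ι ℝ) : ‖Mᵀ * M‖ = ‖M‖ * ‖M‖ := by
  simpa using l2_opNorm_conjTranspose_mul_self M

lemma IsConferenceMatrix.l2_opNorm_le_sqrt {n : ℕ} (hn : 0 < n) {S : Matrix (Fin n) (Fin n) ℝ}
    (hS : IsConferenceMatrix S) : ‖S‖ ≤ √n := by
  have : Nonempty (Fin n) := ⟨⟨0, hn⟩⟩
  refine Real.le_sqrt_of_sq_le ?_
  have h1 : (1 : ℝ) ≤ n := by exact_mod_cast hn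
  rw [sq, ← l2_opNorm_transpose_mul_self, hS.2.2.2, norm_smul, norm_one, mul_one,
    Real.norm_of_nonneg (by linarith)]
  linarith

lemma IsConferenceMatrix.l2_opNorm_mul_self_le_two {n : ℕ} (hn : 0 < n)
    {S F : Matrix (Fin n) (Fin n) ℝ} (hS : IsConferenceMatrix S)
    (hF : Fᵀ * F = 1 + (√n)⁻¹ • S) : ‖F‖ * ‖F‖ ≤ 2 := by
  have : Nonempty (Fin n) := ⟨⟨0, hn⟩⟩
  have hpos : 0 < √(n : ℝ) := Real.sqrt_pos.2 (by exact_mod_cast hn)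
  rw [← l2_opNorm_transpose_mul_self, hF]
  calc ‖1 + (√n)⁻¹ • S‖ ≤ ‖(1 : Matrix (Fin n) (Fin n) ℝ)‖ + ‖(√n)⁻¹ • S‖ := norm_add_le _ _
    _ ≤ 1 + (√n)⁻¹ * √n := by
        rw [norm_one, norm_smul, Real.norm_of_nonneg (inv_nonneg.2 hpos.le)]
        gcongr
        exact hS.l2_opNorm_le_sqrt hn
    _ = 2 := by rw [inv_mul_cancel₀ hpos.ne']; norm_num

lemma trace_diagonal_conj_pow (F : Matrix ι ι ℝ) (x : ι → ℝ) (k : ℕ) :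
    trace ((diagonal x * (Fᵀ * F) * diagonal x) ^ k)
      = trace ((F * diagonal (fun i => x i ^ 2) * Fᵀ) ^ k) := by
  have h1 : diagonal x * (Fᵀ * F) * diagonal x = (diagonal x * Fᵀ) * (F * diagonal x) := by
    simp only [Matrix.mul_assoc]
  have h2 : F * diagonal (fun i => x i ^ 2) * Fᵀ = (F * diagonal x) * (diagonal x * Fᵀ) := by
    simp only [sq, ← diagonal_mul_diagonal, Matrix.mul_assoc]
  rw [h1, h2, trace_mul_pow_comm]

lemma abs_trace_diagonal_conj_pow_sub_le [Nonempty ι] {F : Matrix ι ι ℝ} (hF : ‖F‖ * ‖F‖ ≤ 2)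
    {x y : ι → ℝ} (hx : ∀ i, |x i| ≤ 2) (hy : ∀ i, |y i| ≤ 2) (k : ℕ) :
    |trace ((diagonal x * (Fᵀ * F) * diagonal x) ^ k)
        - trace ((diagonal y * (Fᵀ * F) * diagonal y) ^ k)|
      ≤ 8 ^ k * k * ∑ i, |x i - y i| := by
  have hnorm : ∀ z : ι → ℝ, (∀ i, |z i| ≤ 2) →
      ‖F * diagonal (fun i => z i ^ 2) * Fᵀ‖ ≤ 8 := by
    intro z hz
    have hd : ‖(diagonal (fun i => z i ^ 2) : Matrix ι ι ℝ)‖ ≤ 4 := by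
      rw [l2_opNorm_diagonal, pi_norm_le_iff_of_nonneg (by norm_num)]
      intro i
      rw [Real.norm_of_nonneg (sq_nonneg _), ← sq_abs]
      nlinarith [hz i, abs_nonneg (z i)]
    calc _ ≤ ‖F * diagonal (fun i => z i ^ 2)‖ * ‖Fᵀ‖ := norm_mul_le _ _
      _ ≤ ‖F‖ * 4 * ‖F‖ := by
          rw [l2_opNorm_transpose]
          gcongr
          exact (norm_mul_le _ _).trans (by gcongr)
      _ ≤ 8 := by linarith
  have hdiff : ∀ N, |trace (N * (F * diagonal (fun i => x i ^ 2) * Fᵀ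
      - F * diagonal (fun i => y i ^ 2) * Fᵀ))| ≤ (8 * ∑ i, |x i - y i|) * ‖N‖ := by
    intro N
    have h1 : trace (N * (F * diagonal (fun i => x i ^ 2) * Fᵀ
        - F * diagonal (fun i => y i ^ 2) * Fᵀ))
        = trace ((Fᵀ * N * F) * diagonal (fun i => x i ^ 2 - y i ^ 2)) := by
      rw [← diagonal_sub, ← Matrix.sub_mul, ← Matrix.mul_sub, ← Matrix.mul_assoc, trace_mul_comm]
      simp only [Matrix.mul_assoc]
    have h2 : ‖Fᵀ * N * F‖ ≤ 2 * ‖N‖ := by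
      calc ‖Fᵀ * N * F‖ ≤ ‖Fᵀ * N‖ * ‖F‖ := norm_mul_le _ _
        _ ≤ ‖F‖ * ‖N‖ * ‖F‖ := by
            gcongr
            exact (norm_mul_le _ _).trans_eq (by rw [l2_opNorm_transpose])
        _ = (‖F‖ * ‖F‖) * ‖N‖ := by ring
        _ ≤ 2 * ‖N‖ := by gcongr
    have h3 : ∑ i, |x i ^ 2 - y i ^ 2| ≤ 4 * ∑ i, |x i - y i| := by
      rw [Finset.mul_sum]
      refine Finset.sum_le_sum fun i _ => ?_
      rw [sq_sub_sq, abs_mul]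
      gcongr
      linarith [abs_add_le (x i) (y i), hx i, hy i]
    rw [h1]
    calc _ ≤ ‖Fᵀ * N * F‖ * ∑ i, |x i ^ 2 - y i ^ 2| := abs_trace_mul_diagonal_le _ _
      _ ≤ (2 * ‖N‖) * (4 * ∑ i, |x i - y i|) := by gcongr
      _ = _ := by ring
  have hsum : 0 ≤ ∑ i, |x i - y i| := Finset.sum_nonneg fun i _ => abs_nonneg _
  have h := abs_trace_pow_sub_pow_mul_le (by positivity) (hnorm x hx) (hnorm y hy) hdiff k 1
  rw [Matrix.mul_one, trace_sub, norm_one] at h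
  rw [trace_diagonal_conj_pow, trace_diagonal_conj_pow]
  linarith

end TraceInequalities

lemma EuclideanSpace.sum_abs_le_sqrt_mul_norm {ι : Type*} [Fintype ι] (v : EuclideanSpace ℝ ι) :
    ∑ i, |v i| ≤ √(Fintype.card ι) * ‖v‖ := by
  have h := sq_sum_le_card_mul_sum_sq (s := Finset.univ) (f := fun i => |v i|)
  simp only [sq_abs, ← EuclideanSpace.real_norm_sq_eq, Finset.card_univ] at h
  refine abs_le_of_sq_le_sq' ?_ (by positivity) |>.2
  rw [mul_pow, Real.sq_sqrt (by positivity)]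
  exact h

lemma Real.sqrt_natCast_le_rpow {n k : ℕ} (hn : 0 < n) (hk : 0 < k) :
    √(n : ℝ) ≤ (n : ℝ) ^ ((1 : ℝ) - 1 / (2 * k)) := by
  rw [Real.sqrt_eq_rpow]
  refine Real.rpow_le_rpow_of_exponent_le (by exact_mod_cast hn) ?_
  have hk' : (1 : ℝ) ≤ k := by exact_mod_cast hk
  have : 1 / (2 * (k : ℝ)) ≤ 1 / 2 := by
    apply one_div_le_one_div_of_le <;> linarith
  linarith

/-- The map `f(x) = ‖F diag(x)‖_{S^{2k}}^{2k} = tr((diag(x) FᵀF diag(x))^k)`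
is convex and `8^k k n^{1 - 1/(2k)}`-Lipschitz (in the Euclidean norm) on
`{x : ‖x‖_∞ < 2}`. -/
theorem stmt11 (k n : ℕ) (hk : 0 < k) (S F : Matrix (Fin n) (Fin n) ℝ)
    (hS : IsConferenceMatrix S)
    (hF : F.transpose * F = 1 + (Real.sqrt n)⁻¹ • S) :
    let f := fun x : EuclideanSpace ℝ (Fin n) =>
      Matrix.trace ((Matrix.diagonal (fun i => x i) * (F.transpose * F) *
        Matrix.diagonal (fun i => x i)) ^ k)
    let D := {x : EuclideanSpace ℝ (Fin n) | ∀ i, |x i| < 2}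
    ConvexOn ℝ D f ∧
      ∀ x ∈ D, ∀ y ∈ D,
        |f x - f y| ≤ 8 ^ k * k * (n : ℝ) ^ ((1 : ℝ) - 1 / (2 * k)) * ‖x - y‖ := by
  intro f D
  constructor
  · let L : EuclideanSpace ℝ (Fin n) →ₗ[ℝ] Matrix (Fin n) (Fin n) ℝ :=
      { toFun := fun x => F * Matrix.diagonal (fun i => x i)
        map_add' := fun x y => by
          rw [← Matrix.mul_add, Matrix.diagonal_add]
          rfl
        map_smul' := fun c x => by
          rw [RingHom.id_apply, ← Matrix.mul_smul, ← Matrix.diagonal_smul]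
          rfl }
    have hD : Convex ℝ D := by
      intro x hx y hy a b ha hb hab i
      have h : Convex ℝ {t : ℝ | |t| < 2} := by
        simpa [Metric.ball, Real.dist_eq] using convex_ball (0 : ℝ) 2
      exact h (hx i) (hy i) ha hb hab
    have hconv := ((convexOn_trace_gram_pow (ι := Fin n) k).comp_linearMap L).subset
      (Set.subset_univ D) hD
    refine hconv.congr fun x _ => ?_
    simp only [L, f, Function.comp_apply, LinearMap.coe_mk, AddHom.coe_mk,
      Matrix.transpose_mul, Matrix.diagonal_transpose, Matrix.mul_assoc]
  · intro x hx y hy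
    rcases Nat.eq_zero_or_pos n with rfl | hn
    · simp [Subsingleton.elim x y]
    have : Nonempty (Fin n) := ⟨⟨0, hn⟩⟩
    have h := abs_trace_diagonal_conj_pow_sub_le (hS.l2_opNorm_mul_self_le_two hn hF)
      (fun i => (hx i).le) (fun i => (hy i).le) k
    have hsum := EuclideanSpace.sum_abs_le_sqrt_mul_norm (x - y)
    rw [Fintype.card_fin] at hsum
    calc |f x - f y| ≤ 8 ^ k * k * ∑ i, |(x - y) i| := h
      _ ≤ 8 ^ k * k * ((n : ℝ) ^ ((1 : ℝ) - 1 / (2 * k)) * ‖x - y‖) := by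
          gcongr
          refine hsum.trans ?_
          gcongr
          exact Real.sqrt_natCast_le_rpow hn hk
      _ = _ := by ring
end

section
/- Fix k, t ∈ ℕ and let π ∈ Π(k,t) be a loop-free non-crossing partition such that the multigraph G_π contains a cycle of odd length. Then for any sequence of symmetric conference matrices S_n of increasing sizes n, the quantity V_n(π) := (1/n^{k/2+1}) Σ_{a ∈ L_n(π)} Δ(a(1),...,a(k)) satisfies V_n(π) → 0 as n → ∞. -/
open MeasureTheory ProbabilityTheory Filter Finset
open scoped ENNReal

lemma cyc_castSucc {k : ℕ} (j : Fin k) : cyc j.castSucc = j.succ := by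
  ext
  simp [cyc, Nat.mod_eq_of_lt]

lemma cyc_last (k : ℕ) : cyc (Fin.last k) = 0 := by
  ext
  simp [cyc]

lemma cyc_eq_add_one {k : ℕ} (i : Fin (k + 1)) : cyc i = i + 1 := by
  ext
  simp [cyc, Fin.val_add]

/-- A walk whose two endpoints agree closes up cyclically after dropping the last position. -/
lemma closed_walk_cyc {V : Type} {k : ℕ} (u : Fin (k + 1) → V) (hu : u (Fin.last k) = u 0)
    (j : Fin k) : u (cyc j).castSucc = u j.succ := by
  obtain _ | k := k
  · exact j.elim0
  induction j using Fin.lastCases with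
  | last => rw [cyc_last, Fin.succ_last, hu, Fin.castSucc_zero]
  | cast i => rw [cyc_castSucc, Fin.succ_castSucc]

/-- The vertices can be 2-coloured so that every step of the closed walk `w` changes colour. -/
def WalkBipartite {V : Type} {k : ℕ} (w : Fin k → V) : Prop :=
  ∃ c : V → Bool, ∀ i, c (w i) ≠ c (w (cyc i))

lemma WalkBipartite.of_comp {V W : Type} {k : ℕ} {w : Fin k → V} {g : V → W}
    (h : WalkBipartite (g ∘ w)) : WalkBipartite w := by
  obtain ⟨c, hc⟩ := h
  exact ⟨c ∘ g, hc⟩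

lemma WalkBipartite.of_rotate {V : Type} {k : ℕ} {w : Fin (k + 1) → V} {r : Fin (k + 1)}
    (h : WalkBipartite fun i => w (i + r)) : WalkBipartite w := by
  obtain ⟨c, hc⟩ := h
  refine ⟨c, fun i => ?_⟩
  have := hc (i - r)
  simp only [cyc_eq_add_one] at this ⊢
  rwa [add_right_comm, sub_add_cancel] at this

lemma Delta_rotate {k n : ℕ} (S : Matrix (Fin n) (Fin n) ℝ) (a : Fin (k + 1) → Fin n)
    (r : Fin (k + 1)) : Delta S (fun i => a (i + r)) = Delta S a := by
  unfold Delta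
  rw [← Equiv.prod_comp (Equiv.addRight r) fun i => S (a i) (a (cyc i))]
  refine Finset.prod_congr rfl fun i _ => ?_
  simp only [cyc_eq_add_one, Equiv.coe_addRight]
  rw [add_right_comm]

namespace IsConferenceMatrix

variable {n : ℕ} {S : Matrix (Fin n) (Fin n) ℝ}

lemma abs_le_one_s18 (hS : IsConferenceMatrix S) (i j : Fin n) : |S i j| ≤ 1 := by
  by_cases h : i = j
  · subst h
    simp [hS.2.1]
  · rcases hS.2.2.1 i j h with h | h <;> simp [h]

lemma mul_self_eq_one (hS : IsConferenceMatrix S) {i j : Fin n} (h : i ≠ j) :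
    S i j * S j i = 1 := by
  rw [hS.1.apply i j]
  rcases hS.2.2.1 i j h with h | h <;> simp [h]

lemma sum_mul_eq_zero (hS : IsConferenceMatrix S) {i j : Fin n} (h : i ≠ j) :
    ∑ x, S i x * S x j = 0 := by
  have := congrFun (congrFun hS.2.2.2 i) j
  rw [hS.1.eq, Matrix.mul_apply] at this
  simpa [Matrix.one_apply_ne h] using this

lemma abs_Delta_le_one (hS : IsConferenceMatrix S) {k : ℕ} (a : Fin k → Fin n) :
    |Delta S a| ≤ 1 := by
  rw [Delta, Finset.abs_prod]
  exact Finset.prod_le_one (fun _ _ => abs_nonneg _) fun _ _ => hS.abs_le_one_s18 _ _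

end IsConferenceMatrix

/-- The sum of `Δ` over all labellings of the closed walk `w` that are injective on vertices. -/
noncomputable def injSum {V : Type} [Fintype V] {k n : ℕ}
    (S : Matrix (Fin n) (Fin n) ℝ) (w : Fin k → V) : ℝ :=
  ∑ f : V ↪ Fin n, Delta S (f ∘ w)

section injSum

variable {V : Type} {n : ℕ} {S : Matrix (Fin n) (Fin n) ℝ}

/-- The product over a closed walk passing through a vertex at its last position only. -/
lemma Delta_of_last {k : ℕ} (w : Fin (k + 2) → Option V) (u : Fin (k + 1) → V)
    (hw : ∀ j, w j.castSucc = some (u j)) (hl : w (Fin.last _) = none) (f : Option V → Fin n) :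
    Delta S (f ∘ w) =
      (∏ j : Fin k, S (f (some (u j.castSucc))) (f (some (u j.succ)))) *
        (S (f (some (u (Fin.last k)))) (f none) * S (f none) (f (some (u 0)))) := by
  rw [Delta, Fin.prod_univ_castSucc, Fin.prod_univ_castSucc, mul_assoc]
  have h0 : w 0 = some (u 0) := hw 0
  simp only [Function.comp_apply, cyc_last, cyc_castSucc, Fin.succ_castSucc, Fin.succ_last, hw,
    hl, h0]

variable [Fintype V]

lemma sum_option_embedding (F : (V → Fin n) → Fin n → ℝ) :
    ∑ f : Option V ↪ Fin n, F (fun v => f (some v)) (f none) =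
      ∑ f : V ↪ Fin n, ∑ x ∈ Finset.univ \ Finset.univ.image f, F f x := by
  classical
  rw [Fintype.sum_equiv (Function.Embedding.optionEmbeddingEquiv V (Fin n))
    (fun f => F (fun v => f (some v)) (f none)) (fun p => F p.1 p.2) fun f => rfl,
    Fintype.sum_sigma]
  refine Finset.sum_congr rfl fun f _ => ?_
  exact (Finset.sum_subtype (Finset.univ \ Finset.univ.image f) (p := (· ∈ (Set.range f)ᶜ))
    (fun x => by simp) (F f)).symm

lemma injSum_equiv {W : Type} [Fintype W] {k : ℕ} (e : V ≃ W) (w : Fin k → V) :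
    injSum S (e ∘ w) = injSum S w := by
  unfold injSum
  refine Fintype.sum_equiv (Equiv.embeddingCongr e.symm (Equiv.refl _)) _ _ fun f => ?_
  congr 1

lemma injSum_rotate {k : ℕ} (w : Fin (k + 1) → V) (r : Fin (k + 1)) :
    injSum S (fun i => w (i + r)) = injSum S w :=
  Finset.sum_congr rfl fun f _ => Delta_rotate S (f ∘ w) r

/-- If every vertex is visited at least twice, counting labellings is enough. -/
lemma abs_injSum_le_of_two_le [DecidableEq V] (hn : 0 < n) (hS : IsConferenceMatrix S) {k : ℕ} (w : Fin k → V)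
    (h : ∀ v, 2 ≤ #{i | w i = v}) : |injSum S w| ≤ √n ^ k := by
  have hk : 2 * Fintype.card V ≤ k := by
    have h1 := Finset.card_eq_sum_card_fiberwise (s := (Finset.univ : Finset (Fin k)))
      (t := (Finset.univ : Finset V)) (f := w) fun _ _ => Finset.mem_coe.2 (Finset.mem_univ _)
    have h2 := Finset.card_nsmul_le_sum Finset.univ (fun v => #{i | w i = v}) 2 fun v _ => h v
    simp only [Finset.card_univ, Fintype.card_fin, smul_eq_mul] at h1 h2
    omega
  have h1 : (1 : ℝ) ≤ √n := by
    rw [Real.one_le_sqrt]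
    exact_mod_cast hn
  calc |injSum S w| ≤ ∑ f : V ↪ Fin n, |Delta S (f ∘ w)| := Finset.abs_sum_le_sum_abs _ _
    _ ≤ ∑ f : V ↪ Fin n, (1 : ℝ) := Finset.sum_le_sum fun f _ => hS.abs_Delta_le_one _
    _ = (Fintype.card (V ↪ Fin n) : ℝ) := by simp
    _ ≤ (Fintype.card (V → Fin n) : ℝ) := by
      exact_mod_cast Fintype.card_le_of_injective _ DFunLike.coe_injective
    _ = √n ^ (2 * Fintype.card V) := by
      rw [pow_mul, Real.sq_sqrt (Nat.cast_nonneg n)]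
      simp
    _ ≤ √n ^ k := pow_le_pow_right₀ h1 hk

/-- A vertex visited once, between two visits of one vertex, can be deleted. -/
lemma abs_injSum_le_of_backtrack (hS : IsConferenceMatrix S) {k : ℕ}
    (w : Fin (k + 2) → Option V) (u : Fin (k + 1) → V)
    (hw : ∀ j, w j.castSucc = some (u j)) (hl : w (Fin.last _) = none)
    (hu : u (Fin.last k) = u 0) :
    |injSum S w| ≤ n * |injSum S fun j : Fin k => u j.castSucc| := by
  have key : injSum S w =
      ((n - Fintype.card V : ℕ) : ℝ) * injSum S fun j : Fin k => u j.castSucc := by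
    unfold injSum
    simp only [Delta_of_last w u hw hl]
    rw [sum_option_embedding (fun g x => (∏ j : Fin k, S (g (u j.castSucc)) (g (u j.succ))) *
        (S (g (u (Fin.last k))) x * S x (g (u 0)))), Finset.mul_sum]
    refine Finset.sum_congr rfl fun f _ => ?_
    have hone : ∀ x ∈ Finset.univ \ Finset.univ.image f,
        (∏ j : Fin k, S (f (u j.castSucc)) (f (u j.succ))) *
          (S (f (u (Fin.last k))) x * S x (f (u 0))) =
        ∏ j : Fin k, S (f (u j.castSucc)) (f (u j.succ)) := by
      intro x hx
      rw [hu, hS.mul_self_eq_one, mul_one]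
      rintro rfl
      simp at hx
    rw [Finset.sum_congr rfl hone, Finset.sum_const, nsmul_eq_mul,
      Finset.card_sdiff_of_subset (Finset.subset_univ _),
      Finset.card_image_of_injective _ f.injective]
    simp only [Finset.card_univ, Fintype.card_fin, Delta, Function.comp_apply,
      closed_walk_cyc u hu]
  rw [key, abs_mul, Nat.abs_cast]
  gcongr
  exact Nat.sub_le _ _

/-- A vertex visited once, between two distinct vertices, can be merged into the others. -/
lemma injSum_eq_neg_sum_merge (hS : IsConferenceMatrix S) {k : ℕ}
    (w : Fin (k + 2) → Option V) (u : Fin (k + 1) → V)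
    (hw : ∀ j, w j.castSucc = some (u j)) (hl : w (Fin.last _) = none)
    (hu : u (Fin.last k) ≠ u 0) :
    injSum S w = -∑ y : V, injSum S ((fun o : Option V => o.getD y) ∘ w) := by
  unfold injSum
  rw [Finset.sum_comm, ← Finset.sum_neg_distrib]
  simp only [Delta_of_last w u hw hl]
  rw [sum_option_embedding (fun g x => (∏ j : Fin k, S (g (u j.castSucc)) (g (u j.succ))) *
      (S (g (u (Fin.last k))) x * S x (g (u 0))))]
  refine Finset.sum_congr rfl fun f _ => ?_
  have hmerge : ∀ y, Delta S (f ∘ (fun o : Option V => o.getD y) ∘ w) =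
      (∏ j : Fin k, S (f (u j.castSucc)) (f (u j.succ))) *
        (S (f (u (Fin.last k))) (f y) * S (f y) (f (u 0))) := fun y =>
    Delta_of_last w u hw hl (fun o => f (o.getD y))
  simp only [hmerge]
  rw [← Finset.mul_sum, ← Finset.mul_sum, ← mul_neg]
  congr 1
  have hsplit := Finset.sum_sdiff (Finset.subset_univ (Finset.univ.image f))
    (f := fun x => S (f (u (Fin.last k))) x * S x (f (u 0)))
  rw [hS.sum_mul_eq_zero (f.injective.ne hu), Finset.sum_image f.injective.injOn] at hsplit
  linarith

end injSum

/-- The sum of `Δ` over injective labellings of a non-bipartite closed walk with `k` steps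
is `O(n ^ (k / 2))`. -/
theorem abs_injSum_le (m : ℕ) : ∀ (k : ℕ) (V : Type) [Fintype V] [DecidableEq V] (w : Fin k → V),
    Fintype.card V = m → Function.Surjective w → ¬ WalkBipartite w →
    ∀ (n : ℕ), 0 < n → ∀ S : Matrix (Fin n) (Fin n) ℝ, IsConferenceMatrix S →
      |injSum S w| ≤ m.factorial * √n ^ k := by
  induction m with
  | zero =>
    intro k V _ _ w hV _ hw
    have := Fintype.card_eq_zero_iff.1 hV
    exact absurd ⟨fun _ => true, fun i => isEmptyElim (w i)⟩ hw
  | succ m ih =>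
    intro k V _ _ w hV hsurj hnb n hn S hS
    by_cases h2 : ∀ v, 2 ≤ #{i | w i = v}
    · refine (abs_injSum_le_of_two_le hn hS w h2).trans (le_mul_of_one_le_left (by positivity) ?_)
      exact_mod_cast Nat.one_le_iff_ne_zero.2 (Nat.factorial_ne_zero _)
    push Not at h2
    obtain ⟨v, hv⟩ := h2
    obtain ⟨i₀, hi₀⟩ := hsurj v
    have huniq : ∀ i, w i = v → i = i₀ := fun i hi =>
      Finset.card_le_one.1 (Nat.lt_succ_iff.1 hv) i (by simpa using hi) i₀ (by simpa using hi₀)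
    obtain _ | _ | k := k
    · exact i₀.elim0
    · have : injSum S w = 0 := Finset.sum_eq_zero fun f _ => by
        simp [Delta, hS.2.1, Fin.fin_one_eq_zero]
      rw [this, abs_zero]
      positivity
    let e : V ≃ Option {x // x ≠ v} := (Equiv.optionSubtypeNe v).symm
    let r : Fin (k + 2) := i₀ - Fin.last _
    let w' : Fin (k + 2) → Option {x // x ≠ v} := fun i => (e ∘ w) (i + r)
    have hsum : injSum S w' = injSum S w := by
      rw [injSum_rotate (e ∘ w) r, injSum_equiv]
    have hnb' : ¬ WalkBipartite w' := fun h => hnb h.of_rotate.of_comp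
    have hsurj' : Function.Surjective w' :=
      (e.surjective.comp hsurj).comp (Equiv.addRight r).surjective
    have hl : w' (Fin.last _) = none := by
      simp [w', r, e, hi₀]
    have hne : ∀ j : Fin (k + 1), ∃ x, w' j.castSucc = some x := by
      intro j
      rw [← Option.ne_none_iff_exists']
      intro h
      have h3 : w (j.castSucc + r) = v := by
        apply e.injective
        rw [show e v = none by simp [e]]
        exact h
      have h4 : j.castSucc = Fin.last _ := by
        rw [eq_sub_of_add_eq (huniq _ h3)]
        simp [r]
      exact (Fin.castSucc_lt_last j).ne h4
    choose u hu using hne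
    have hcard : Fintype.card {x // x ≠ v} = m := by
      simp [Fintype.card_subtype_compl, hV]
    have husurj : Function.Surjective u := by
      intro y
      obtain ⟨i, hi⟩ := hsurj' (some y)
      induction i using Fin.lastCases with
      | last => simp [hl] at hi
      | cast j => exact ⟨j, by simpa [hu] using hi⟩
    rw [← hsum]
    by_cases hends : u (Fin.last k) = u 0
    · have hk0 : k ≠ 0 := by
        rintro rfl
        refine hnb' ⟨Option.isSome, fun i => ?_⟩
        induction i using Fin.lastCases with
        | last =>
          have h0 : w' 0 = some (u 0) := hu 0
          rw [cyc_last, hl, h0]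
          simp
        | cast j =>
          rw [Subsingleton.elim j (Fin.last 0), cyc_castSucc, Fin.succ_last, hl, hu]
          simp
      have hred := ih k _ (fun j : Fin k => u j.castSucc) hcard ?_ ?_ n hn S hS
      · have h1 := abs_injSum_le_of_backtrack hS w' u hu hl hends
        calc |injSum S w'| ≤ n * |injSum S fun j : Fin k => u j.castSucc| := h1
          _ ≤ n * (m.factorial * √n ^ k) := by gcongr
          _ = m.factorial * √n ^ (k + 2) := by
            rw [pow_add, Real.sq_sqrt (Nat.cast_nonneg n)]
            ring
          _ ≤ (m + 1).factorial * √n ^ (k + 2) := by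
            gcongr
            exact Nat.le_succ m
      · intro y
        obtain ⟨j, hj⟩ := husurj y
        induction j using Fin.lastCases with
        | last =>
          obtain ⟨k, rfl⟩ := Nat.exists_eq_succ_of_ne_zero hk0
          exact ⟨0, by simpa [hends] using hj⟩
        | cast j => exact ⟨j, hj⟩
      · rintro ⟨c, hc⟩
        simp only [closed_walk_cyc u hends] at hc
        refine hnb' ⟨fun o => o.elim (!c (u 0)) c, fun i => ?_⟩
        have h0 : w' 0 = some (u 0) := hu 0
        induction i using Fin.lastCases with
        | last => simp [hl, cyc_last, h0]
        | cast j =>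
          rw [cyc_castSucc, hu]
          induction j using Fin.lastCases with
          | last => simp [hl, hends]
          | cast j =>
            rw [Fin.succ_castSucc, hu]
            exact hc j
    · rw [injSum_eq_neg_sum_merge hS w' u hu hl hends, abs_neg]
      calc |∑ y, injSum S ((fun o : Option {x // x ≠ v} => o.getD y) ∘ w')|
          ≤ ∑ y, |injSum S ((fun o : Option {x // x ≠ v} => o.getD y) ∘ w')| :=
            Finset.abs_sum_le_sum_abs _ _
        _ ≤ ∑ _y : {x // x ≠ v}, m.factorial * √n ^ (k + 2) := by
          refine Finset.sum_le_sum fun y _ => ih _ _ _ hcard ?_ ?_ n hn S hS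
          · exact Function.Surjective.comp (fun x => ⟨some x, rfl⟩) hsurj'
          · exact fun h => hnb' h.of_comp
        _ = m * (m.factorial * √n ^ (k + 2)) := by
          rw [Finset.sum_const, Finset.card_univ, hcard, nsmul_eq_mul]
        _ ≤ (m + 1).factorial * √n ^ (k + 2) := by
          rw [Nat.factorial_succ, ← mul_assoc]
          push_cast
          gcongr
          linarith

section partition

variable {k : ℕ} {π : Finset (Finset (Fin k))}

lemma IsPartitionOf.part_eq (hπ : IsPartitionOf k π) {i : Fin k} {B : Finset (Fin k)}
    (hB : B ∈ π) (hi : i ∈ B) : part π i = B := by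
  ext j
  simp only [part, Finset.mem_filter, Finset.mem_univ, true_and]
  refine ⟨fun h => (h B hB).1 hi, fun hj C hC => ⟨fun h => ?_, fun h => ?_⟩⟩
  · rwa [(hπ.2 i).unique ⟨hC, h⟩ ⟨hB, hi⟩]
  · rwa [(hπ.2 j).unique ⟨hC, h⟩ ⟨hB, hj⟩]

lemma IsPartitionOf.part_mem (hπ : IsPartitionOf k π) (i : Fin k) : part π i ∈ π := by
  obtain ⟨B, ⟨hB, hi⟩, -⟩ := hπ.2 i
  rwa [hπ.part_eq hB hi]

lemma mem_part_self (π : Finset (Finset (Fin k))) (i : Fin k) : i ∈ part π i := by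
  simp [part]

lemma IsPartitionOf.mem_part (hπ : IsPartitionOf k π) {i j : Fin k} :
    j ∈ part π i ↔ part π j = part π i :=
  ⟨fun h => hπ.part_eq (hπ.part_mem i) h, fun h => h ▸ mem_part_self π j⟩

/-- The closed walk on the blocks of `π` that visits `π(1), …, π(k)` in turn. -/
def blockWalk (hπ : IsPartitionOf k π) (i : Fin k) : {B // B ∈ π} :=
  ⟨part π i, hπ.part_mem i⟩

lemma blockWalk_surjective (hπ : IsPartitionOf k π) : Function.Surjective (blockWalk hπ) := by
  rintro ⟨B, hB⟩
  obtain ⟨i, hi⟩ := Finset.nonempty_iff_ne_empty.2 fun h : B = ∅ => hπ.1 (h ▸ hB)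
  exact ⟨i, Subtype.ext (hπ.part_eq hB hi)⟩

lemma mem_Ln_iff (hπ : IsPartitionOf k π) {n : ℕ} {a : Fin k → Fin n} :
    a ∈ Ln n π ↔ ∀ i j, a j = a i ↔ blockWalk hπ j = blockWalk hπ i := by
  have hb : ∀ i j, blockWalk hπ j = blockWalk hπ i ↔ j ∈ part π i := fun i j => by
    rw [hπ.mem_part, blockWalk, blockWalk, Subtype.mk.injEq]
  simp only [Ln, Finset.mem_filter, Finset.mem_univ, true_and, hb]
  constructor
  · intro h i j
    have hmem : (Finset.univ.filter fun j => a j = a i) ∈ π := by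
      rw [← h]
      exact Finset.mem_image_of_mem _ (Finset.mem_univ i)
    rw [hπ.part_eq hmem (i := i) (by simp)]
    simp
  · intro h
    ext B
    simp only [levelSets, Finset.mem_image, Finset.mem_univ, true_and, h, Finset.filter_univ_mem]
    constructor
    · rintro ⟨i, rfl⟩
      exact hπ.part_mem i
    · intro hB
      obtain ⟨i, hi⟩ := blockWalk_surjective hπ ⟨B, hB⟩
      exact ⟨i, congrArg Subtype.val hi⟩

lemma sum_Ln_eq_injSum (hπ : IsPartitionOf k π) {n : ℕ} (S : Matrix (Fin n) (Fin n) ℝ) :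
    ∑ a ∈ Ln n π, Delta S a = injSum S (blockWalk hπ) := by
  symm
  refine Finset.sum_bij (fun f _ => f ∘ blockWalk hπ) (fun f _ => ?_) (fun f _ g _ h => ?_)
    (fun a ha => ?_) fun _ _ => rfl
  · exact (mem_Ln_iff hπ).2 fun i j => f.injective.eq_iff
  · exact DFunLike.coe_injective ((blockWalk_surjective hπ).injective_comp_right h)
  · rw [mem_Ln_iff hπ] at ha
    have hs := Function.surjInv_eq (blockWalk_surjective hπ)
    refine ⟨⟨fun B => a (Function.surjInv (blockWalk_surjective hπ) B), fun B C h => ?_⟩,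
      Finset.mem_univ _, ?_⟩
    · simpa [ha, hs] using h
    · exact funext fun i => (ha _ _).2 (hs _)

/-- An odd cycle in `G_π` obstructs 2-colouring. -/
lemma not_walkBipartite_blockWalk (hπ : IsPartitionOf k π) {T : Finset (Fin k)} {ℓ : ℕ}
    (hodd : Odd ℓ) (hT : IsSimpleCycleOn π T ℓ) : ¬ WalkBipartite (blockWalk hπ) := by
  rintro ⟨c, hc⟩
  obtain ⟨-, e, v, -, hv⟩ := hT
  let d : Finset (Fin k) → Bool := fun B => if h : B ∈ π then c ⟨B, h⟩ else true
  have hd : ∀ i, d (part π i) = c (blockWalk hπ i) := fun i => dif_pos (hπ.part_mem i)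
  have hstep : ∀ i, d (v (i + 1)) = !d (v i) := by
    intro i
    have := hc (e i)
    rw [← hd, ← hd] at this
    rcases hv i with ⟨h1, h2⟩ | ⟨h1, h2⟩ <;> rw [h1, h2] at this
    · exact Bool.eq_not.2 this.symm
    · exact Bool.eq_not.2 this
  have hiter : ∀ j : ℕ, d (v (j : ZMod ℓ)) = (d (v 0) ^^ decide (Odd j)) := by
    intro j
    induction j with
    | zero => simp
    | succ j ih =>
      rw [Nat.cast_succ, hstep, ih]
      by_cases h : Odd j <;> simp [h, Nat.odd_add_one]
  simpa [hodd] using hiter ℓ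

end partition

/-- If `π ∈ Π(k,t)` is loop-free and non-crossing and `G_π` contains a
simple cycle of odd length, then `V_n(π) → 0` along any sequence of symmetric conference
matrices of increasing sizes. -/
theorem stmt18 (k t : ℕ) (π : Finset (Finset (Fin k)))
    (hπ : IsPartitionOf k π) (hcard : π.card = t)
    (hloop : LoopFree π) (hnc : ¬ IsCrossing π)
    (hodd : ∃ (T : Finset (Fin k)) (ℓ : ℕ), Odd ℓ ∧ IsSimpleCycleOn π T ℓ)
    (n : ℕ → ℕ) (hmono : StrictMono n)
    (S : ∀ i, Matrix (Fin (n i)) (Fin (n i)) ℝ)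
    (hS : ∀ i, IsConferenceMatrix (S i)) :
    Tendsto (fun i => Vn (n i) (S i) π) atTop (nhds 0) := by
  have hnb : ¬ WalkBipartite (blockWalk hπ) := by
    obtain ⟨T, ℓ, hℓ, hT⟩ := hodd
    exact not_walkBipartite_blockWalk hπ hℓ hT
  have hlim : Tendsto (fun i => (t.factorial : ℝ) / (n i : ℝ)) atTop (nhds 0) :=
    (tendsto_natCast_atTop_atTop.comp hmono.tendsto_atTop).const_div_atTop _
  refine squeeze_zero_norm' ?_ hlim
  filter_upwards [hmono.tendsto_atTop.eventually_gt_atTop 0] with i hi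
  have hpos : (0 : ℝ) < n i := by exact_mod_cast hi
  have hbound := abs_injSum_le t k {B // B ∈ π} (blockWalk hπ) (by simp [hcard])
    (blockWalk_surjective hπ) hnb (n i) hi (S i) (hS i)
  have hpow : (n i : ℝ) ^ ((k : ℝ) / 2 + 1) = √(n i) ^ k * n i := by
    rw [Real.rpow_add_one hpos.ne', Real.sqrt_eq_rpow, ← Real.rpow_mul_natCast hpos.le]
    congr 2
    ring
  rw [Vn, sum_Ln_eq_injSum hπ, hpow, Real.norm_eq_abs, abs_div,
    abs_of_pos (a := √(n i : ℝ) ^ k * n i) (by positivity), div_le_div_iff₀ (by positivity) hpos]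
  calc _ ≤ (t.factorial * √(n i) ^ k) * (n i : ℝ) := by gcongr
    _ = _ := by ring
end
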